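/- arXiv:2310.00806 — 4 statements merged into one kernel-verified Lean document; each statement's English description precedes it below -/
import Mathlib

section
/- Bounding AIR by DEC: for every η > 0, the supremum over q ∈ Δ(Π) with all coordinates positive and over ν ∈ Δ(𝓜×Π) of the infimum over p ∈ Δ(Π) of AIR_{q,η}(p,ν) equals DEC^KL_η(conv(𝓜)), and this common value is at most DEC_η(conv(𝓜)). -/
open Finset

/-- The probability simplex on a finite set. -/
def IsProb {S : Type*} [Fintype S] (p : S → ℝ) : Prop :=
  (∀ x, 0 ≤ p x) ∧ ∑ x, p x = 1

/-- KL divergence between probability vectors on a finite set, real-valued formula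
`Σ_x p(x)·log(p(x)/q(x))`; the convention `0·log(0/y) = 0` is automatic since
`0 * _ = 0` in `ℝ`. -/
noncomputable def KLr {S : Type*} [Fintype S] (p q : S → ℝ) : ℝ :=
  ∑ x, p x * Real.log (p x / q x)

/-- Marginal distribution of the optimal decision `π*` under a belief `ν ∈ Δ(𝓜×Π)`. -/
noncomputable def margPi {M P : Type*} [Fintype M] [Fintype P] (ν : M × P → ℝ) : P → ℝ :=
  fun π' => ∑ m, ν (m, π')

/-- `m_ν(π,o) = Σ_{M,π'} ν(M,π')·[M(π)](o)`, the probability of observing `o`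
after playing `π`, under belief `ν` with observation kernels `Mo`. -/
noncomputable def mObs {M P O : Type*} [Fintype M] [Fintype P] [Fintype O]
    (Mo : M → P → O → ℝ) (ν : M × P → ℝ) (π : P) (o : O) : ℝ :=
  ∑ x : M × P, ν x * Mo x.1 π o

/-- Marginal posterior of `π*` given `(π,o)` under belief `ν`:
`ν_{π*|π,o}(π̄) = Σ_M ν(M,π̄)·[M(π)](o) / m_ν(π,o)` (Lean's `x/0 = 0` convention
harmlessly handles the zero-probability case, whose summands carry zero weight). -/
noncomputable def post {M P O : Type*} [Fintype M] [Fintype P] [Fintype O]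
    (Mo : M → P → O → ℝ) (ν : M × P → ℝ) (π : P) (o : O) : P → ℝ :=
  fun π' => (∑ m, ν (m, π') * Mo m π o) / mObs Mo ν π o

/-- Algorithmic Information Ratio
`AIR_{q,η}(p,ν) = Σ_{M,π̄,π,o} ν(M,π̄)·p(π)·[M(π)](o)·(f_M(π̄) − f_M(π) − (1/η)·KL(ν_{π*|π,o},q))`. -/
noncomputable def AIR {M P O : Type*} [Fintype M] [Fintype P] [Fintype O]
    (Mo : M → P → O → ℝ) (f : M → P → ℝ)
    (q p : P → ℝ) (η : ℝ) (ν : M × P → ℝ) : ℝ :=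
  ∑ x : M × P, ∑ π, ∑ o, ν x * p π * Mo x.1 π o *
    (f x.1 x.2 - f x.1 π - (1 / η) * KLr (post Mo ν π o) q)

/-- Squared Hellinger distance between probability vectors on a finite set. -/
noncomputable def Hsq {S : Type*} [Fintype S] (p q : S → ℝ) : ℝ :=
  ∑ x, (Real.sqrt (p x) - Real.sqrt (q x)) ^ 2

open scoped Classical in
/-- Extended-real-valued KL divergence on a finite set, with the convention
`KL(p,q) = +∞` if `p(x) > 0 = q(x)` for some `x`, and `0·log(0/y) = 0` otherwise. -/
noncomputable def KLe {S : Type*} [Fintype S] (p q : S → ℝ) : EReal :=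
  if ∀ x, 0 < p x → 0 < q x then ((∑ x, p x * Real.log (p x / q x) : ℝ) : EReal) else ⊤

/-- A model is a pair: an observation kernel `Π → Δ(O)` together with a mean reward
function `Π → ℝ`; model classes are sets of such pairs, and `conv` is the convex hull
in this product space (for a finite class, exactly the mixture models). -/
abbrev ModelPair (P O : Type*) := (P → O → ℝ) × (P → ℝ)

/-- KL version of the decision-estimation coefficient of a class `C` of models:
`DEC^KL_η(C) = sup_{M̄ ∈ conv(C)} inf_{p ∈ Δ(Π)} sup_{M ∈ C}
  Σ_π p(π)·( f_M(π_M) − f_M(π) − (1/η)·KL(M(π), M̄(π)) )`,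
with `f_M(π_M) = max_{π'} f_M(π')`, valued in the extended reals. -/
noncomputable def decKLgen {P O : Type*} [Fintype P] [Nonempty P] [Fintype O]
    (C : Set (ModelPair P O)) (η : ℝ) : EReal :=
  ⨆ Mb ∈ convexHull ℝ C, ⨅ p ∈ {p : P → ℝ | IsProb p}, ⨆ Mi ∈ C,
    ∑ π, (p π : EReal) *
      ((((⨆ π', Mi.2 π') - Mi.2 π : ℝ) : EReal)
        - ((1 / η : ℝ) : EReal) * KLe (Mi.1 π) (Mb.1 π))

/-- Squared-Hellinger version of the decision-estimation coefficient `DEC_η(C)`. -/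
noncomputable def decHgen {P O : Type*} [Fintype P] [Nonempty P] [Fintype O]
    (C : Set (ModelPair P O)) (η : ℝ) : EReal :=
  ⨆ Mb ∈ convexHull ℝ C, ⨅ p ∈ {p : P → ℝ | IsProb p}, ⨆ Mi ∈ C,
    ((∑ π, p π * ((⨆ π', Mi.2 π') - Mi.2 π - (1 / η) * Hsq (Mi.1 π) (Mb.1 π)) : ℝ) : EReal)

section LogSum

/-- Tangent-line lower bound for the perspective of `t ↦ t * log t`. -/
lemma mul_add_sub_mul_exp_le_mul_log_div {a b : ℝ} (ha : 0 ≤ a) (hb : 0 ≤ b)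
    (hab : b = 0 → a = 0) (c : ℝ) :
    a * c + a - b * Real.exp c ≤ a * Real.log (a / b) := by
  rcases ha.eq_or_lt with rfl | ha
  · simpa using mul_nonneg hb (Real.exp_pos c).le
  have hb : 0 < b := hb.lt_of_ne fun h => ha.ne' (hab h.symm)
  have h := Real.add_one_le_exp (c - Real.log (a / b))
  rw [Real.exp_sub, Real.exp_log (by positivity)] at h
  have h2 := mul_le_mul_of_nonneg_left h ha.le
  have h3 : a * (Real.exp c / (a / b)) = b * Real.exp c := by field_simp
  linarith

/-- The log-sum inequality. -/
lemma sum_mul_log_div_sum_le {S : Type*} (s : Finset S) {a b : S → ℝ}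
    (ha : ∀ i ∈ s, 0 ≤ a i) (hb : ∀ i ∈ s, 0 ≤ b i) (hab : ∀ i ∈ s, b i = 0 → a i = 0) :
    (∑ i ∈ s, a i) * Real.log ((∑ i ∈ s, a i) / ∑ i ∈ s, b i)
      ≤ ∑ i ∈ s, a i * Real.log (a i / b i) := by
  rcases (sum_nonneg ha).eq_or_lt with hA | hA
  · have h0 := (sum_eq_zero_iff_of_nonneg ha).1 hA.symm
    rw [← hA, zero_mul, sum_eq_zero fun i hi => by rw [h0 i hi, zero_mul]]
  have hB : 0 < ∑ i ∈ s, b i := (sum_nonneg hb).lt_of_ne fun hB =>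
    hA.ne' (sum_eq_zero fun i hi => hab i hi ((sum_eq_zero_iff_of_nonneg hb).1 hB.symm i hi))
  have h := sum_le_sum fun i hi => mul_add_sub_mul_exp_le_mul_log_div (ha i hi) (hb i hi)
    (hab i hi) (Real.log ((∑ i ∈ s, a i) / ∑ i ∈ s, b i))
  rw [sum_sub_distrib, sum_add_distrib, ← sum_mul, ← sum_mul, Real.exp_log (by positivity),
    mul_div_cancel₀ _ hB.ne'] at h
  linarith

lemma convex_comb_mul_log_div_le {a₁ a₂ b₁ b₂ s t : ℝ} (hs : 0 ≤ s) (ht : 0 ≤ t)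
    (ha₁ : 0 ≤ a₁) (ha₂ : 0 ≤ a₂) (hb₁ : 0 ≤ b₁) (hb₂ : 0 ≤ b₂)
    (h₁ : b₁ = 0 → a₁ = 0) (h₂ : b₂ = 0 → a₂ = 0) :
    (s * a₁ + t * a₂) * Real.log ((s * a₁ + t * a₂) / (s * b₁ + t * b₂))
      ≤ s * (a₁ * Real.log (a₁ / b₁)) + t * (a₂ * Real.log (a₂ / b₂)) := by
  have key : ∀ r a b : ℝ, r * (a * Real.log (a / b)) = r * a * Real.log (r * a / (r * b)) := by
    intro r a b
    rcases eq_or_ne r 0 with rfl | hr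
    · simp
    · rw [mul_div_mul_left _ _ hr, mul_assoc]
  have h := sum_mul_log_div_sum_le (univ : Finset (Fin 2))
    (a := ![s * a₁, t * a₂]) (b := ![s * b₁, t * b₂])
    (by simp [Fin.forall_fin_two]; constructor <;> positivity)
    (by simp [Fin.forall_fin_two]; constructor <;> positivity)
    (by simp [Fin.forall_fin_two]; tauto)
  simpa [Fin.sum_univ_two, key] using h

lemma KLr_nonneg {S : Type*} [Fintype S] {p q : S → ℝ} (hp : IsProb p) (hq : IsProb q)
    (h : ∀ x, q x = 0 → p x = 0) : 0 ≤ KLr p q := by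
  have := sum_mul_log_div_sum_le univ (fun i _ => hp.1 i) (fun i _ => hq.1 i) (fun i _ => h i)
  rwa [hp.2, hq.2, div_one, Real.log_one, mul_zero] at this

lemma mul_log_div_le_of_mul_le {a b b' s : ℝ} (ha : 0 ≤ a) (hs : 0 < s) (hb : 0 ≤ b)
    (h : b = 0 → a = 0) (hbb : s * b ≤ b') :
    a * Real.log (a / b') ≤ a * Real.log (a / b) + a * -Real.log s := by
  rcases ha.eq_or_lt with rfl | ha
  · simp
  have hb : 0 < b := hb.lt_of_ne fun h' => ha.ne' (h h'.symm)
  have hb' : 0 < b' := (mul_pos hs hb).trans_le hbb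
  have := Real.log_le_log (mul_pos hs hb) hbb
  rw [Real.log_mul hs.ne' hb.ne'] at this
  rw [← mul_add, Real.log_div ha.ne' hb.ne', Real.log_div ha.ne' hb'.ne']
  exact mul_le_mul_of_nonneg_left (by linarith) ha.le

lemma KLr_le_of_mul_le {S : Type*} [Fintype S] {p q q' : S → ℝ} {s : ℝ} (hp : IsProb p)
    (hs : 0 < s) (hq : ∀ x, 0 ≤ q x) (h : ∀ x, q x = 0 → p x = 0)
    (hqq : ∀ x, s * q x ≤ q' x) : KLr p q' ≤ KLr p q - Real.log s := by
  have := sum_le_sum fun x (_ : x ∈ univ) =>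
    mul_log_div_le_of_mul_le (hp.1 x) hs (hq x) (h x) (hqq x)
  rw [sum_add_distrib, ← sum_mul, hp.2, one_mul] at this
  exact this

lemma Hsq_le_KLr {S : Type*} [Fintype S] {p q : S → ℝ} (hp : IsProb p) (hq : IsProb q)
    (h : ∀ x, q x = 0 → p x = 0) : Hsq p q ≤ KLr p q := by
  have key : ∀ x, (√(p x) - √(q x)) ^ 2 + p x - q x ≤ p x * Real.log (p x / q x) := by
    intro x
    have hp0 := hp.1 x
    have hq0 := hq.1 x
    rcases hp0.eq_or_lt with hpx | hpx
    · rw [← hpx]; simp [Real.sq_sqrt hq0]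
    have hqx : 0 < q x := hq0.lt_of_ne fun h' => hpx.ne' (h x h'.symm)
    have hl := Real.log_le_sub_one_of_pos (div_pos (Real.sqrt_pos.2 hqx) (Real.sqrt_pos.2 hpx))
    rw [Real.log_div (Real.sqrt_pos.2 hqx).ne' (Real.sqrt_pos.2 hpx).ne', Real.log_sqrt hq0,
      Real.log_sqrt hp0] at hl
    have h2 := mul_le_mul_of_nonneg_left hl hp0
    have h3 : p x * (√(q x) / √(p x) - 1) = √(p x) * √(q x) - p x := by
      have hne := (Real.sqrt_pos.2 hpx).ne'
      have := Real.sq_sqrt hp0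
      field_simp
      linear_combination -√(q x) * this
    rw [Real.log_div hpx.ne' hqx.ne', sub_sq, Real.sq_sqrt hp0, Real.sq_sqrt hq0]
    linarith
  have := sum_le_sum fun x (_ : x ∈ univ) => key x
  rw [sum_sub_distrib, sum_add_distrib, hp.2, hq.2] at this
  simpa [Hsq, KLr] using this

end LogSum

section Minimax

/-- A minimax theorem for finitely many concave payoffs on a convex set. -/
lemma exists_isProb_forall_sum_mul_le {P E : Type*} [Fintype P] [AddCommGroup E]
    [Module ℝ E] {S : Set E} (hS : S.Nonempty) {G : P → E → ℝ}
    (hG : ∀ π, ConcaveOn ℝ S (G π)) {c : ℝ} (h : ∀ ν ∈ S, ∃ π, G π ν ≤ c) :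
    ∃ p : P → ℝ, IsProb p ∧ ∀ ν ∈ S, ∑ π, p π * G π ν ≤ c := by
  classical
  obtain ⟨ν₀, hν₀⟩ := hS
  have hSc : Convex ℝ S := by
    obtain ⟨π, -⟩ := h ν₀ hν₀
    exact (hG π).1
  let U : Set (P → ℝ) := Set.univ.pi fun _ => Set.Ioi c
  let K : Set (P → ℝ) := {u | ∃ ν ∈ S, ∀ π, u π ≤ G π ν}
  have hU : Convex ℝ U := convex_pi fun _ _ => convex_Ioi c
  have hUo : IsOpen U := isOpen_set_pi Set.finite_univ fun _ _ => isOpen_Ioi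
  have hK : Convex ℝ K := by
    rintro u ⟨ν, hν, hu⟩ v ⟨ν', hν', hv⟩ s t hs ht hst
    refine ⟨s • ν + t • ν', hSc hν hν' hs ht hst, fun π => ?_⟩
    refine le_trans ?_ ((hG π).2 hν hν' hs ht hst)
    simp only [Pi.add_apply, Pi.smul_apply, smul_eq_mul]
    exact add_le_add (mul_le_mul_of_nonneg_left (hu π) hs)
      (mul_le_mul_of_nonneg_left (hv π) ht)
  have hd : Disjoint U K := by
    rw [Set.disjoint_left]
    rintro u hu ⟨ν, hν, hk⟩
    obtain ⟨π, hπ⟩ := h ν hν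
    have h1 : c < u π := hu π trivial
    linarith [hk π]
  obtain ⟨F, r, hFU, hFK⟩ := geometric_hahn_banach_open hU hUo hK hd
  let g : P → ℝ := fun π => F (Pi.single π 1)
  have hF : ∀ u, F u = ∑ π, u π * g π := by
    intro u
    conv_lhs => rw [pi_eq_sum_univ' u]
    simp [g]
  have hg : ∀ π, g π ≤ 0 := by
    intro π
    by_contra! hpos
    have hmem : ∀ t : ℝ, 0 ≤ t → (fun π => G π ν₀) - t • Pi.single π 1 ∈ K := by
      intro t ht
      refine ⟨ν₀, hν₀, fun π' => ?_⟩
      have : 0 ≤ (Pi.single π 1 : P → ℝ) π' := by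
        by_cases hh : π' = π
        · subst hh; simp
        · simp [hh]
      simp only [Pi.sub_apply, Pi.smul_apply, smul_eq_mul]
      nlinarith [mul_nonneg ht this]
    have h0 := hFK _ (hmem 0 le_rfl)
    simp only [zero_smul, sub_zero] at h0
    have ht : 0 ≤ (F (fun π => G π ν₀) - r + 1) / g π := by
      apply div_nonneg _ hpos.le
      linarith
    have h1 := hFK _ (hmem _ ht)
    rw [map_sub, map_smul, smul_eq_mul] at h1
    change r ≤ _ - _ * g π at h1
    rw [div_mul_cancel₀ _ hpos.ne'] at h1
    linarith
  have hFc : ∀ t, 0 < t → (c + t) * ∑ π, g π < r := by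
    intro t ht
    have := hFU (fun _ => c + t) fun π _ => by simpa using ht
    rwa [hF, ← mul_sum] at this
  have hW : ∑ π, g π < 0 := by
    refine (sum_nonpos fun π _ => hg π).lt_of_ne fun h0 => ?_
    have hz : ∀ π, g π = 0 := fun π =>
      (sum_eq_zero_iff_of_nonpos fun π _ => hg π).1 h0 π (mem_univ π)
    have h1 := hFc 1 one_pos
    have h2 := hFK _ ⟨ν₀, hν₀, fun π => le_rfl⟩
    rw [hF] at h2
    simp [hz] at h1 h2
    linarith
  have hr : c * ∑ π, g π ≤ r := by
    refine le_of_forall_pos_lt_add fun e he => ?_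
    have := hFc (e / -∑ π, g π) (div_pos he (by linarith))
    have h3 : e / (-∑ π, g π) * ∑ π, g π = -e := by
      rw [div_neg, neg_mul, div_mul_cancel₀ _ hW.ne]
    rw [add_mul, h3] at this
    linarith
  refine ⟨fun π => g π / ∑ π, g π, ⟨fun π => div_nonneg_of_nonpos (hg π) hW.le, ?_⟩, ?_⟩
  · rw [← sum_div, div_self hW.ne]
  · intro ν hν
    have := hFK _ ⟨ν, hν, fun π => le_rfl⟩
    rw [hF] at this
    have h4 : ∑ π, g π / (∑ π, g π) * G π ν = (∑ π, G π ν * g π) / ∑ π, g π := by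
      rw [sum_div]
      exact sum_congr rfl fun π _ => by ring
    rw [h4, div_le_iff_of_neg hW]
    linarith

end Minimax

section Mixture

variable {P O ι : Type*} [Fintype ι]

/-- The mixture of the models `(Mo i, f i)` with weights `μ`. -/
def mixModel (Mo : ι → P → O → ℝ) (f : ι → P → ℝ) (μ : ι → ℝ) : ModelPair P O :=
  (fun π o => ∑ i, μ i * Mo i π o, fun π => ∑ i, μ i * f i π)

lemma mem_convexHull_range_iff_exists_mixModel (Mo : ι → P → O → ℝ) (f : ι → P → ℝ)
    (A : ModelPair P O) :
    A ∈ convexHull ℝ (Set.range fun i => ((Mo i, f i) : ModelPair P O)) ↔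
      ∃ μ, IsProb μ ∧ mixModel Mo f μ = A := by
  classical
  constructor
  · intro h
    refine convexHull_min (t := {A | ∃ μ, IsProb μ ∧ mixModel Mo f μ = A}) ?_ ?_ h
    · rintro _ ⟨i, rfl⟩
      refine ⟨Pi.single i 1, ⟨fun j => ?_, by simp⟩, ?_⟩
      · by_cases hj : j = i
        · subst hj; simp
        · simp [hj]
      · ext <;> simp [mixModel, Pi.single_apply]
    · rintro _ ⟨μ, hμ, rfl⟩ _ ⟨μ', hμ', rfl⟩ s t hs ht hst
      refine ⟨fun i => s * μ i + t * μ' i, ⟨fun i => ?_, ?_⟩, ?_⟩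
      · exact add_nonneg (mul_nonneg hs (hμ.1 i)) (mul_nonneg ht (hμ'.1 i))
      · rw [sum_add_distrib, ← mul_sum, ← mul_sum, hμ.2, hμ'.2, mul_one, mul_one, hst]
      · ext <;> simp [mixModel, mul_sum, add_mul, sum_add_distrib, mul_assoc]
  · rintro ⟨μ, hμ, rfl⟩
    have : mixModel Mo f μ = ∑ i, μ i • ((Mo i, f i) : ModelPair P O) := by
      ext <;> simp [mixModel, Prod.fst_sum, Prod.snd_sum]
    rw [this]
    exact (convex_convexHull ℝ _).sum_mem (fun i _ => hμ.1 i) hμ.2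
      fun i _ => subset_convexHull ℝ _ ⟨i, rfl⟩

lemma isProb_mixModel [Fintype O] {Mo : ι → P → O → ℝ} (hMo : ∀ i π, IsProb (Mo i π))
    (f : ι → P → ℝ) {μ : ι → ℝ} (hμ : IsProb μ) (π : P) :
    IsProb ((mixModel Mo f μ).1 π) := by
  refine ⟨fun o => sum_nonneg fun i _ => mul_nonneg (hμ.1 i) ((hMo i π).1 o), ?_⟩
  simp only [mixModel]
  rw [sum_comm]
  simp_rw [← mul_sum, (hMo _ π).2, mul_one, hμ.2]

end Mixture

section Information

variable {P O : Type*} [Fintype P] [Fintype O]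

/-- Relative entropy of an unnormalised joint distribution with respect to a product. -/
noncomputable def jointInfo (w : P → O → ℝ) (a : P → ℝ) (b : O → ℝ) : ℝ :=
  ∑ π', ∑ o, w π' o * Real.log (w π' o / (a π' * b o))

lemma jointInfo_change_left {w : P → O → ℝ} {a a' : P → ℝ} {b : O → ℝ}
    (ha : ∀ π' o, a π' = 0 → w π' o = 0) (ha' : ∀ π' o, a' π' = 0 → w π' o = 0)
    (hb : ∀ π' o, b o = 0 → w π' o = 0) :
    jointInfo w a b = jointInfo w a' b + ∑ π', (∑ o, w π' o) * Real.log (a' π' / a π') := by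
  simp only [jointInfo, sum_mul, ← sum_add_distrib]
  refine sum_congr rfl fun π' _ => sum_congr rfl fun o _ => ?_
  by_cases hw : w π' o = 0
  · simp [hw]
  have h1 : a π' ≠ 0 := fun h => hw (ha _ _ h)
  have h2 : a' π' ≠ 0 := fun h => hw (ha' _ _ h)
  have h3 : b o ≠ 0 := fun h => hw (hb _ _ h)
  rw [Real.log_div hw (mul_ne_zero h1 h3), Real.log_div hw (mul_ne_zero h2 h3),
    Real.log_div h2 h1, Real.log_mul h1 h3, Real.log_mul h2 h3]
  ring

lemma jointInfo_change_right {w : P → O → ℝ} {a : P → ℝ} {b b' : O → ℝ}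
    (ha : ∀ π' o, a π' = 0 → w π' o = 0) (hb : ∀ π' o, b o = 0 → w π' o = 0)
    (hb' : ∀ π' o, b' o = 0 → w π' o = 0) :
    jointInfo w a b = jointInfo w a b' + ∑ o, (∑ π', w π' o) * Real.log (b' o / b o) := by
  have h : ∑ o, (∑ π', w π' o) * Real.log (b' o / b o)
      = ∑ π', ∑ o, w π' o * Real.log (b' o / b o) := by
    rw [sum_comm]; simp only [sum_mul]
  rw [h]
  simp only [jointInfo, ← sum_add_distrib]
  refine sum_congr rfl fun π' _ => sum_congr rfl fun o _ => ?_
  by_cases hw : w π' o = 0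
  · simp [hw]
  have h1 : a π' ≠ 0 := fun h => hw (ha _ _ h)
  have h2 : b' o ≠ 0 := fun h => hw (hb' _ _ h)
  have h3 : b o ≠ 0 := fun h => hw (hb _ _ h)
  rw [Real.log_div hw (mul_ne_zero h1 h3), Real.log_div hw (mul_ne_zero h1 h2),
    Real.log_div h2 h3, Real.log_mul h1 h3, Real.log_mul h1 h2]
  ring

end Information

section Belief

variable {P O ι : Type*} [Fintype ι]

/-- Joint weight of the optimal decision `π'` and the observation `o` after playing `π`. -/
def jointObs (Mo : ι → P → O → ℝ) (ν : ι × P → ℝ) (π π' : P) (o : O) : ℝ :=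
  ∑ i, ν (i, π') * Mo i π o

lemma jointObs_eq_zero_of_forall {Mo : ι → P → O → ℝ} {ν : ι × P → ℝ} {π : P} (π' : P) {o : O}
    (h : ∀ i, Mo i π o = 0) : jointObs Mo ν π π' o = 0 :=
  sum_eq_zero fun i _ => by rw [h, mul_zero]

variable [Fintype P]

/-- Expected regret of `π` under the belief `ν`. -/
def beliefRegret (f : ι → P → ℝ) (ν : ι × P → ℝ) (π : P) : ℝ :=
  ∑ x : ι × P, ν x * (f x.1 x.2 - f x.1 π)

variable {Mo : ι → P → O → ℝ} {ν : ι × P → ℝ}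

lemma isProb_margPi (hν : IsProb ν) : IsProb (margPi ν) :=
  ⟨fun _ => sum_nonneg fun _ _ => hν.1 _, by rw [← hν.2, Fintype.sum_prod_type_right]; rfl⟩

lemma isProb_margFst (hν : IsProb ν) : IsProb fun i => ∑ π', ν (i, π') :=
  ⟨fun _ => sum_nonneg fun _ _ => hν.1 _, by rw [← hν.2, Fintype.sum_prod_type]⟩

lemma eq_zero_of_margPi (hν : IsProb ν) {π' : P} (h : margPi ν π' = 0) (i : ι) :
    ν (i, π') = 0 :=
  (sum_eq_zero_iff_of_nonneg fun i _ => hν.1 (i, π')).1 h i (mem_univ _)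

lemma jointObs_eq_zero_of_margPi (hν : IsProb ν) {π : P} (π' : P) (o : O)
    (h : margPi ν π' = 0) : jointObs Mo ν π π' o = 0 :=
  sum_eq_zero fun i _ => by rw [eq_zero_of_margPi hν h, zero_mul]

variable [Fintype O]

lemma mObs_eq_mixModel (f : ι → P → ℝ) (π : P) :
    mObs Mo ν π = (mixModel Mo f fun i => ∑ π', ν (i, π')).1 π := by
  ext o
  simp [mObs, mixModel, Fintype.sum_prod_type, sum_mul]

lemma isProb_mObs (hMo : ∀ i π, IsProb (Mo i π)) (hν : IsProb ν) (π : P) :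
    IsProb (mObs Mo ν π) := by
  rw [mObs_eq_mixModel 0]
  exact isProb_mixModel hMo 0 (isProb_margFst hν) π

lemma sum_jointObs_fst (π : P) (o : O) : ∑ π', jointObs Mo ν π π' o = mObs Mo ν π o := by
  rw [mObs, Fintype.sum_prod_type_right]; rfl

lemma sum_jointObs_snd (hMo : ∀ i π, IsProb (Mo i π)) (π π' : P) :
    ∑ o, jointObs Mo ν π π' o = margPi ν π' := by
  simp only [jointObs, margPi]
  rw [sum_comm]
  simp_rw [← mul_sum, (hMo _ π).2, mul_one]

lemma jointObs_nonneg (hMo : ∀ i π, IsProb (Mo i π)) (hν : IsProb ν) (π π' : P) (o : O) :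
    0 ≤ jointObs Mo ν π π' o :=
  sum_nonneg fun i _ => mul_nonneg (hν.1 _) ((hMo i π).1 o)

lemma jointObs_eq_zero_of_mObs (hMo : ∀ i π, IsProb (Mo i π)) (hν : IsProb ν) {π : P}
    (π' : P) (o : O) (h : mObs Mo ν π o = 0) : jointObs Mo ν π π' o = 0 := by
  rw [← sum_jointObs_fst] at h
  exact (sum_eq_zero_iff_of_nonneg fun π' _ => jointObs_nonneg hMo hν π π' o).1 h π' (mem_univ _)

/-- `AIR` is linear in the decision distribution. -/
lemma AIR_eq_sum (hMo : ∀ i π, IsProb (Mo i π)) (f : ι → P → ℝ) (q p : P → ℝ) (η : ℝ)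
    (hν : IsProb ν) :
    AIR Mo f q p η ν = ∑ π, p π * (beliefRegret f ν π
      - 1 / η * jointInfo (jointObs Mo ν π) q (mObs Mo ν π)) := by
  rw [AIR, sum_comm]
  refine sum_congr rfl fun π _ => ?_
  have hK : jointInfo (jointObs Mo ν π) q (mObs Mo ν π)
      = ∑ o, mObs Mo ν π o * KLr (post Mo ν π o) q := by
    rw [jointInfo, sum_comm]
    refine sum_congr rfl fun o _ => ?_
    rw [KLr, mul_sum]
    refine sum_congr rfl fun π' _ => ?_
    change _ = mObs Mo ν π o * (jointObs Mo ν π π' o / mObs Mo ν π o *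
      Real.log (jointObs Mo ν π π' o / mObs Mo ν π o / q π'))
    by_cases h : mObs Mo ν π o = 0
    · simp [h, jointObs_eq_zero_of_mObs hMo hν π' o h]
    · rw [← mul_assoc, mul_div_cancel₀ _ h, div_div, mul_comm (mObs Mo ν π o)]
  have hR : ∀ x : ι × P, ∑ o, ν x * p π * Mo x.1 π o *
      (f x.1 x.2 - f x.1 π - 1 / η * KLr (post Mo ν π o) q)
      = p π * (ν x * (f x.1 x.2 - f x.1 π))
        - p π * (1 / η * ∑ o, ν x * Mo x.1 π o * KLr (post Mo ν π o) q) := by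
    intro x
    have h1 : p π * (ν x * (f x.1 x.2 - f x.1 π))
        = ∑ o, Mo x.1 π o * (p π * (ν x * (f x.1 x.2 - f x.1 π))) := by
      rw [← sum_mul, (hMo x.1 π).2, one_mul]
    rw [h1, mul_sum, mul_sum, ← sum_sub_distrib]
    exact sum_congr rfl fun o _ => by ring
  rw [sum_congr rfl fun x _ => hR x, sum_sub_distrib, ← mul_sum, ← mul_sum, ← mul_sum, mul_sub,
    hK, sum_comm]
  simp only [mObs, sum_mul, beliefRegret]

end Belief

section Payoff

variable {P O ι : Type*} [Fintype P] [Fintype O] [Fintype ι]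

lemma KLe_eq_coe_KLr {S : Type*} [Fintype S] {p q : S → ℝ} (h : ∀ x, 0 < p x → 0 < q x) :
    KLe p q = (KLr p q : EReal) := by
  rw [KLe, if_pos h]; rfl

lemma KLe_eq_top {S : Type*} [Fintype S] {p q : S → ℝ} (h : ¬ ∀ x, 0 < p x → 0 < q x) :
    KLe p q = ⊤ := if_neg h

lemma coe_sum_eq_sum_coe {S : Type*} [Fintype S] (g : S → ℝ) :
    ((∑ x, g x : ℝ) : EReal) = ∑ x, (g x : EReal) :=
  map_sum (⟨⟨Real.toEReal, rfl⟩, EReal.coe_add⟩ : ℝ →+ EReal) g univ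

lemma sum_coe_mul_eq_coe {r k : P → ℝ} {p : P → ℝ} {η : ℝ} :
    ∑ π, (p π : EReal) * ((r π : EReal) - ((1 / η : ℝ) : EReal) * (k π : EReal))
      = ((∑ π, p π * (r π - 1 / η * k π) : ℝ) : EReal) := by
  rw [coe_sum_eq_sum_coe]
  exact sum_congr rfl fun π _ => by push_cast; rfl

lemma sum_coe_mul_le_coe {S : Type*} [Fintype S] {p r d : P → ℝ} {A B : P → S → ℝ} {η : ℝ}
    (hη : 0 < η) (hp : ∀ π, 0 ≤ p π)
    (h : ∀ π, (∀ x, 0 < A π x → 0 < B π x) → r π - 1 / η * KLr (A π) (B π) ≤ d π) :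
    ∑ π, (p π : EReal) * ((r π : EReal) - ((1 / η : ℝ) : EReal) * KLe (A π) (B π))
      ≤ ((∑ π, p π * d π : ℝ) : EReal) := by
  rw [coe_sum_eq_sum_coe]
  refine sum_le_sum fun π _ => ?_
  rcases (hp π).eq_or_lt with h0 | h0
  · simp [← h0]
  by_cases hs : ∀ x, 0 < A π x → 0 < B π x
  · rw [KLe_eq_coe_KLr hs]
    exact_mod_cast mul_le_mul_of_nonneg_left (h π hs) h0.le
  · rw [KLe_eq_top hs, EReal.coe_mul_top_of_pos (by positivity), EReal.sub_top,
      EReal.coe_mul_bot_of_pos h0]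
    exact bot_le

variable {Mo : ι → P → O → ℝ} {ν : ι × P → ℝ}

lemma exists_AIR_le_sum_mul_sub_KLr (hMo : ∀ i π, IsProb (Mo i π)) (f : ι → P → ℝ) {η : ℝ}
    (hη : 0 < η) {p q : P → ℝ} (hp : IsProb p) (hq : IsProb q) (hq0 : ∀ π, 0 < q π)
    (hν : IsProb ν) :
    ∃ π', 0 < margPi ν π' ∧ AIR Mo f q p η ν ≤ ∑ π, p π *
      ((mixModel Mo f fun i => ν (i, π') / margPi ν π').2 π'
        - (mixModel Mo f fun i => ν (i, π') / margPi ν π').2 π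
        - 1 / η * KLr ((mixModel Mo f fun i => ν (i, π') / margPi ν π').1 π)
          (mObs Mo ν π)) := by
  set n := margPi ν
  have hn : IsProb n := isProb_margPi hν
  let C : P → ModelPair P O := fun π' => mixModel Mo f fun i => ν (i, π') / n π'
  let c : P → ℝ := fun π' => ∑ π, p π * ((C π').2 π' - (C π').2 π
    - 1 / η * KLr ((C π').1 π) (mObs Mo ν π))
  have hC1 : ∀ π' π o, (C π').1 π o = jointObs Mo ν π π' o / n π' := fun π' π o => by
    simp [C, mixModel, jointObs, sum_div, div_mul_eq_mul_div]
  have hC2 : ∀ π' π, n π' * (C π').2 π = ∑ i, ν (i, π') * f i π := fun π' π => by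
    simp only [C, mixModel, mul_sum]
    refine sum_congr rfl fun i _ => ?_
    by_cases h : n π' = 0
    · rw [eq_zero_of_margPi hν h]; simp
    · field_simp
  have hinfo : ∀ π, ∑ π', n π' * KLr ((C π').1 π) (mObs Mo ν π)
      = jointInfo (jointObs Mo ν π) n (mObs Mo ν π) := fun π => by
    refine sum_congr rfl fun π' _ => ?_
    rw [KLr, mul_sum]
    refine sum_congr rfl fun o _ => ?_
    rw [hC1, div_div]
    by_cases h : n π' = 0
    · rw [jointObs_eq_zero_of_margPi hν π' o h]; simp
    · rw [← mul_assoc, mul_div_cancel₀ _ h]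
  have hreg : ∀ π, ∑ π', n π' * ((C π').2 π' - (C π').2 π) = beliefRegret f ν π := fun π => by
    rw [beliefRegret, Fintype.sum_prod_type_right]
    refine sum_congr rfl fun π' _ => ?_
    rw [mul_sub, hC2, hC2, ← sum_sub_distrib]
    exact sum_congr rfl fun i _ => by ring
  have hle : AIR Mo f q p η ν ≤ ∑ π', n π' * c π' := by
    have : ∑ π', n π' * c π' = ∑ π, p π * (beliefRegret f ν π
        - 1 / η * jointInfo (jointObs Mo ν π) n (mObs Mo ν π)) := by
      simp only [c, mul_sum]
      rw [sum_comm]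
      refine sum_congr rfl fun π _ => ?_
      rw [← hreg, ← hinfo, mul_sum, ← sum_sub_distrib, mul_sum]
      exact sum_congr rfl fun i _ => by ring
    rw [this, AIR_eq_sum hMo f q p η hν]
    refine sum_le_sum fun π _ => mul_le_mul_of_nonneg_left ?_ (hp.1 π)
    have h1 := jointInfo_change_left (w := jointObs Mo ν π) (a := q) (a' := n)
      (b := mObs Mo ν π) (fun π' o h => absurd h (hq0 π').ne')
      (fun π' o h => jointObs_eq_zero_of_margPi hν π' o h)
      (fun π' o h => jointObs_eq_zero_of_mObs hMo hν π' o h)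
    simp_rw [sum_jointObs_snd hMo] at h1
    have h2 : 0 ≤ KLr n q := KLr_nonneg hn hq fun x h => absurd h (hq0 x).ne'
    have h3 : jointInfo (jointObs Mo ν π) n (mObs Mo ν π)
        ≤ jointInfo (jointObs Mo ν π) q (mObs Mo ν π) := by
      rw [h1]; exact le_add_of_nonneg_right h2
    have := mul_le_mul_of_nonneg_left h3 (one_div_pos.2 hη).le
    linarith
  by_contra! hcon
  obtain ⟨π₀, hπ₀⟩ : ∃ π, 0 < n π := by
    by_contra! hneg
    have := sum_nonpos fun π (_ : π ∈ univ) => hneg π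
    rw [hn.2] at this
    linarith
  have : ∑ π', n π' * c π' < ∑ π', n π' * AIR Mo f q p η ν := by
    refine sum_lt_sum (fun π' _ => ?_) ⟨π₀, mem_univ _, mul_lt_mul_of_pos_left (hcon _ hπ₀) hπ₀⟩
    rcases (hn.1 π').eq_or_lt with h | h
    · simp [← h]
    · exact (mul_lt_mul_of_pos_left (hcon _ h) h).le
  rw [← sum_mul, hn.2, one_mul] at this
  linarith

lemma concaveOn_beliefRegret_sub_jointInfo (hMo : ∀ i π, IsProb (Mo i π)) (f : ι → P → ℝ)
    {η : ℝ} (hη : 0 < η) (π : P) {b : O → ℝ} (hb : ∀ o, 0 ≤ b o)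
    (hb0 : ∀ o, b o = 0 → ∀ i, Mo i π o = 0) :
    ConcaveOn ℝ {ν : ι × P → ℝ | IsProb ν} fun ν =>
      beliefRegret f ν π - 1 / η * jointInfo (jointObs Mo ν π) (margPi ν) b := by
  refine ⟨?_, ?_⟩
  · intro ν hν ν' hν' s t hs ht hst
    refine ⟨fun x => add_nonneg (mul_nonneg hs (hν.1 x)) (mul_nonneg ht (hν'.1 x)), ?_⟩
    simp [sum_add_distrib, ← mul_sum, hν.2, hν'.2, hst]
  · intro ν hν ν' hν' s t hs ht hst
    have hR : beliefRegret f (s • ν + t • ν') π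
        = s * beliefRegret f ν π + t * beliefRegret f ν' π := by
      simp [beliefRegret, mul_sum, ← sum_add_distrib, add_mul, mul_assoc]
    have hJ : ∀ π' o, jointObs Mo (s • ν + t • ν') π π' o
        = s * jointObs Mo ν π π' o + t * jointObs Mo ν' π π' o := fun π' o => by
      simp [jointObs, mul_sum, ← sum_add_distrib, add_mul, mul_assoc]
    have hN : ∀ π', margPi (s • ν + t • ν') π' = s * margPi ν π' + t * margPi ν' π' := fun π' => by
      simp [margPi, mul_sum, ← sum_add_distrib]
    have hz : ∀ {ν : ι × P → ℝ}, IsProb ν → ∀ π' o, margPi ν π' * b o = 0 →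
        jointObs Mo ν π π' o = 0 := fun hν π' o h => by
      rcases mul_eq_zero.1 h with h | h
      · exact jointObs_eq_zero_of_margPi hν π' o h
      · exact jointObs_eq_zero_of_forall π' (hb0 o h)
    have hI : jointInfo (jointObs Mo (s • ν + t • ν') π) (margPi (s • ν + t • ν')) b
        ≤ s * jointInfo (jointObs Mo ν π) (margPi ν) b
          + t * jointInfo (jointObs Mo ν' π) (margPi ν') b := by
      simp only [jointInfo, mul_sum, ← sum_add_distrib]
      refine sum_le_sum fun π' _ => sum_le_sum fun o _ => ?_
      rw [hJ, hN, add_mul _ _ (b o), mul_assoc s (margPi ν π'), mul_assoc t (margPi ν' π')]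
      exact convex_comb_mul_log_div_le hs ht (jointObs_nonneg hMo hν _ _ _)
        (jointObs_nonneg hMo hν' _ _ _) (mul_nonneg ((isProb_margPi hν).1 _) (hb o))
        (mul_nonneg ((isProb_margPi hν').1 _) (hb o)) (hz hν _ _) (hz hν' _ _)
    have := mul_le_mul_of_nonneg_left hI (one_div_pos.2 hη).le
    simp only [smul_eq_mul]
    rw [hR]
    linarith

/-- Replacing the reference distributions by the true marginals, up to a factor `s`. -/
lemma jointInfo_mObs_le (hMo : ∀ i π, IsProb (Mo i π)) (hν : IsProb ν) {π : P} {b : O → ℝ}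
    (hb : IsProb b) (hb0 : ∀ o, b o = 0 → ∀ i, Mo i π o = 0) {q : P → ℝ}
    (hq0 : ∀ π, 0 < q π) {s : ℝ} (hs : 0 < s) (hsq : ∀ π, s * margPi ν π ≤ q π) :
    jointInfo (jointObs Mo ν π) q (mObs Mo ν π)
      ≤ jointInfo (jointObs Mo ν π) (margPi ν) b - Real.log s := by
  have hn := isProb_margPi hν
  have h1 := jointInfo_change_left (w := jointObs Mo ν π) (a := q) (a' := margPi ν)
    (b := mObs Mo ν π) (fun π' o h => absurd h (hq0 π').ne')
    (fun π' o h => jointObs_eq_zero_of_margPi hν π' o h)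
    (fun π' o h => jointObs_eq_zero_of_mObs hMo hν π' o h)
  have h2 := jointInfo_change_right (w := jointObs Mo ν π) (a := margPi ν) (b := b)
    (b' := mObs Mo ν π) (fun π' o h => jointObs_eq_zero_of_margPi hν π' o h)
    (fun π' o h => jointObs_eq_zero_of_forall π' (hb0 o h))
    (fun π' o h => jointObs_eq_zero_of_mObs hMo hν π' o h)
  simp_rw [sum_jointObs_snd hMo] at h1
  simp_rw [sum_jointObs_fst] at h2
  have h3 : 0 ≤ KLr (mObs Mo ν π) b := KLr_nonneg (isProb_mObs hMo hν π) hb fun o h =>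
    sum_eq_zero fun x _ => by rw [hb0 o h, mul_zero]
  have h4 := KLr_le_of_mul_le hn hs hn.1 (fun _ h => h) hsq
  have h5 : KLr (margPi ν) (margPi ν) = 0 := sum_eq_zero fun x _ => by
    by_cases h : margPi ν x = 0
    · simp [h]
    · simp [div_self h]
  rw [h5] at h4
  unfold KLr at h3 h4
  linarith

lemma exists_isProb_pos_mul_le {S : Type*} [Fintype S] [Nonempty S] {p : S → ℝ}
    (hp : IsProb p) {s : ℝ} (hs : 0 < s) (hs1 : s < 1) :
    ∃ q, IsProb q ∧ (∀ x, 0 < q x) ∧ ∀ x, s * p x ≤ q x := by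
  have hc : (0 : ℝ) < Fintype.card S := by exact_mod_cast Fintype.card_pos
  have hu : 0 < (1 - s) / Fintype.card S := div_pos (by linarith) hc
  have h0 : ∀ x, 0 ≤ s * p x := fun x => mul_nonneg hs.le (hp.1 x)
  refine ⟨fun x => s * p x + (1 - s) / Fintype.card S, ⟨fun x => ?_, ?_⟩, fun x => ?_, fun x => ?_⟩
  · linarith [h0 x]
  · rw [sum_add_distrib, ← mul_sum, hp.2, sum_const, card_univ, nsmul_eq_mul,
      mul_div_cancel₀ _ hc.ne']
    ring
  · linarith [h0 x]
  · linarith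

lemma exists_belief_eq_mixModel (Mo : ι → P → O → ℝ) (f : ι → P → ℝ) {μ : ι → ℝ}
    (hμ : IsProb μ) (π₀ : P) :
    ∃ ν : ι × P → ℝ, IsProb ν ∧ ∀ π,
      beliefRegret f ν π = (mixModel Mo f μ).2 π₀ - (mixModel Mo f μ).2 π ∧
      ∀ b, jointInfo (jointObs Mo ν π) (margPi ν) b = KLr ((mixModel Mo f μ).1 π) b := by
  classical
  refine ⟨fun x => if x.2 = π₀ then μ x.1 else 0, ⟨fun x => ?_, ?_⟩, fun π => ⟨?_, fun b => ?_⟩⟩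
  · dsimp only
    split_ifs
    exacts [hμ.1 _, le_rfl]
  · simp [Fintype.sum_prod_type, hμ.2]
  · simp [beliefRegret, Fintype.sum_prod_type, mixModel, ite_mul, mul_sub]
  · rw [jointInfo, sum_eq_single π₀]
    · simp [jointObs, margPi, KLr, mixModel, hμ.2]
    · intro π' _ h
      simp [jointObs, h]
    · simp

end Payoff

/-- Bounding AIR by DEC: for every `η > 0`,
`sup_{q ∈ int Δ(Π)} sup_{ν ∈ Δ(𝓜×Π)} inf_{p ∈ Δ(Π)} AIR_{q,η}(p,ν)
  = DEC^KL_η(conv(𝓜)) ≤ DEC_η(conv(𝓜))`. -/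
theorem air_maximin_eq_decKL_conv
    {P O ι : Type*} [Fintype P] [Nonempty P] [Fintype O] [Nonempty O]
    [Fintype ι] [Nonempty ι]
    (Mo : ι → P → O → ℝ) (hMo : ∀ i π, IsProb (Mo i π))
    (f : ι → P → ℝ) (η : ℝ) (hη : 0 < η) :
    (⨆ q ∈ {q : P → ℝ | IsProb q ∧ ∀ π, 0 < q π},
        ⨆ ν ∈ {ν : ι × P → ℝ | IsProb ν},
          ⨅ p ∈ {p : P → ℝ | IsProb p}, ((AIR Mo f q p η ν : ℝ) : EReal))
        = decKLgen (convexHull ℝ (Set.range fun i => ((Mo i, f i) : ModelPair P O))) η ∧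
    decKLgen (convexHull ℝ (Set.range fun i => ((Mo i, f i) : ModelPair P O))) η
      ≤ decHgen (convexHull ℝ (Set.range fun i => ((Mo i, f i) : ModelPair P O))) η := by
  set C : Set (ModelPair P O) :=
    convexHull ℝ (Set.range fun i => ((Mo i, f i) : ModelPair P O)) with hC
  have hCC : convexHull ℝ C = C := (convex_convexHull ℝ _).convexHull_eq
  have hmem : ∀ A, A ∈ C ↔ ∃ μ, IsProb μ ∧ mixModel Mo f μ = A :=
    mem_convexHull_range_iff_exists_mixModel Mo f
  have hprob : ∀ A ∈ C, ∀ π, IsProb (A.1 π) := by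
    intro A hA π
    obtain ⟨μ, hμ, rfl⟩ := (hmem A).1 hA
    exact isProb_mixModel hMo f hμ π
  refine ⟨le_antisymm ?_ ?_, ?_⟩
  · refine iSup₂_le fun q hq => iSup₂_le fun ν hν => ?_
    have hB : mixModel Mo f (fun i => ∑ π', ν (i, π')) ∈ convexHull ℝ C := by
      rw [hCC, hmem]
      exact ⟨_, isProb_margFst hν, rfl⟩
    refine le_trans ?_ (le_iSup₂_of_le _ hB le_rfl)
    refine le_iInf₂ fun p hp => iInf₂_le_of_le p hp ?_
    obtain ⟨π', hπ', hle⟩ := exists_AIR_le_sum_mul_sub_KLr hMo f hη hp hq.1 hq.2 hν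
    have hμ : IsProb fun i => ν (i, π') / margPi ν π' :=
      ⟨fun i => div_nonneg (hν.1 _) hπ'.le, by rw [← sum_div]; exact div_self hπ'.ne'⟩
    refine le_iSup₂_of_le (mixModel Mo f _) ((hmem _).2 ⟨_, hμ, rfl⟩) ?_
    have hsupp : ∀ π o, 0 < (mixModel Mo f fun i => ν (i, π') / margPi ν π').1 π o →
        0 < (mixModel Mo f fun i => ∑ π', ν (i, π')).1 π o := by
      intro π o h
      rw [← mObs_eq_mixModel]
      refine ((isProb_mObs hMo hν π).1 o).lt_of_ne fun h0 => h.ne' ?_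
      have := jointObs_eq_zero_of_mObs hMo hν π' o h0.symm
      simp only [mixModel, div_mul_eq_mul_div]
      rw [← sum_div]
      exact div_eq_zero_iff.2 (Or.inl this)
    simp_rw [fun π => KLe_eq_coe_KLr (hsupp π)]
    rw [sum_coe_mul_eq_coe, EReal.coe_le_coe_iff]
    refine hle.trans (sum_le_sum fun π _ => mul_le_mul_of_nonneg_left ?_ (hp.1 π))
    rw [← mObs_eq_mixModel]
    have := le_ciSup (Finite.bddAbove_range
      (mixModel Mo f fun i => ν (i, π') / margPi ν π').2) π'
    linarith
  · refine EReal.le_of_forall_lt_iff_le.1 fun c hc => iSup₂_le fun B hB => ?_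
    obtain ⟨c', hLc, hcc⟩ := EReal.lt_iff_exists_real_btwn.1 hc
    rw [EReal.coe_lt_coe_iff] at hcc
    rw [hCC] at hB
    obtain ⟨μ, hμ, rfl⟩ := (hmem B).1 hB
    obtain ⟨s, hs, hs1, hδ⟩ : ∃ s : ℝ, 0 < s ∧ s < 1 ∧ 1 / η * -Real.log s = (c - c') / 2 := by
      refine ⟨Real.exp (-(η * ((c - c') / 2))), Real.exp_pos _, by rw [← Real.exp_zero, Real.exp_lt_exp]; nlinarith, ?_⟩
      rw [Real.log_exp]
      field_simp
    obtain ⟨μ', hμ', hpos, hμμ'⟩ := exists_isProb_pos_mul_le hμ hs hs1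
    have hB' := isProb_mixModel hMo f hμ'
    have hB0 : ∀ π o, (mixModel Mo f μ').1 π o = 0 → ∀ i, Mo i π o = 0 := by
      intro π o h i
      have := (sum_eq_zero_iff_of_nonneg fun i _ =>
        mul_nonneg (hμ'.1 i) ((hMo i π).1 o)).1 h i (mem_univ i)
      exact (mul_eq_zero.1 this).resolve_left (hpos i).ne'
    have hBB : ∀ π o, s * (mixModel Mo f μ).1 π o ≤ (mixModel Mo f μ').1 π o := by
      intro π o
      simp only [mixModel, mul_sum, ← mul_assoc]
      exact sum_le_sum fun i _ => mul_le_mul_of_nonneg_right (hμμ' i) ((hMo i π).1 o)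
    have hne : {ν : ι × P → ℝ | IsProb ν}.Nonempty := by
      obtain ⟨ν, hν, -⟩ := exists_belief_eq_mixModel Mo f hμ (Classical.arbitrary P)
      exact ⟨ν, hν⟩
    obtain ⟨p, hp, hpG⟩ := exists_isProb_forall_sum_mul_le hne
      (fun π => concaveOn_beliefRegret_sub_jointInfo hMo f hη π (hB' π).1 (hB0 π))
      (c := (c + c') / 2) (by
        intro ν hν
        obtain ⟨q, hq, hq0, hqn⟩ := exists_isProb_pos_mul_le (isProb_margPi hν) hs hs1
        have hinf : ⨅ p ∈ {p : P → ℝ | IsProb p}, ((AIR Mo f q p η ν : ℝ) : EReal) < c' :=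
          lt_of_le_of_lt (le_iSup₂_of_le q ⟨hq, hq0⟩ (le_iSup₂
            (f := fun (ν : ι × P → ℝ) (_ : ν ∈ {ν | IsProb ν}) =>
              ⨅ p ∈ {p : P → ℝ | IsProb p}, ((AIR Mo f q p η ν : ℝ) : EReal)) ν hν)) hLc
        obtain ⟨p, hp, hlt⟩ := by simpa only [iInf_lt_iff] using hinf
        rw [EReal.coe_lt_coe_iff, AIR_eq_sum hMo f q p η hν] at hlt
        have hlt' : ∑ π, p π * (beliefRegret f ν π
            - 1 / η * jointInfo (jointObs Mo ν π) q (mObs Mo ν π)) ≤ ∑ π, p π * c' := by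
          rw [← sum_mul, hp.2, one_mul]
          exact hlt.le
        by_contra! hcon
        refine hlt.not_ge ?_
        have := sum_le_sum fun π (_ : π ∈ univ) => mul_le_mul_of_nonneg_left
          (show c' ≤ beliefRegret f ν π
            - 1 / η * jointInfo (jointObs Mo ν π) q (mObs Mo ν π) by
              have h1 := mul_le_mul_of_nonneg_left
                (jointInfo_mObs_le hMo hν (hB' π) (hB0 π) hq0 hs hqn) (one_div_pos.2 hη).le
              have h2 := hcon π
              linarith) (hp.1 π)
        rwa [← sum_mul, hp.2, one_mul] at this)
    refine iInf₂_le_of_le p hp (iSup₂_le fun A hA => ?_)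
    obtain ⟨α, hα, rfl⟩ := (hmem A).1 hA
    obtain ⟨π₀, hπ₀⟩ := exists_eq_ciSup_of_finite (f := (mixModel Mo f α).2)
    obtain ⟨ν, hν, hνα⟩ := exists_belief_eq_mixModel Mo f hα π₀
    refine (sum_coe_mul_le_coe (d := fun π => beliefRegret f ν π
      - 1 / η * jointInfo (jointObs Mo ν π) (margPi ν) ((mixModel Mo f μ').1 π)
      + (c - c') / 2) hη hp.1 fun π hsupp => ?_).trans ?_
    · rw [(hνα π).1, (hνα π).2, ← hπ₀]
      have h1 := KLr_le_of_mul_le (isProb_mixModel hMo f hα π) hs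
        (isProb_mixModel hMo f hμ π).1 (fun o h => by
          by_contra hne
          exact (hsupp o (((isProb_mixModel hMo f hα π).1 o).lt_of_ne' hne)).ne' h) (hBB π)
      have := mul_le_mul_of_nonneg_left h1 (one_div_pos.2 hη).le
      linarith
    · rw [EReal.coe_le_coe_iff]
      have := hpG ν hν
      simp_rw [mul_add]
      rw [sum_add_distrib, ← sum_mul, hp.2]
      linarith
  · refine iSup₂_mono fun B hB => iInf₂_mono fun p hp => iSup₂_mono fun A hA => ?_
    rw [hCC] at hB
    refine sum_coe_mul_le_coe hη hp.1 fun π hsupp => ?_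
    have := mul_le_mul_of_nonneg_left (Hsq_le_KLr (hprob A hA π) (hprob B hB π) fun o h => by
      by_contra hne
      exact (hsupp o (((hprob A hA π).1 o).lt_of_ne' hne)).ne' h) (one_div_pos.2 hη).le
    linarith
end

section
/- Identity at the AIR-maximizing belief (Nash equilibrium): let η > 0, let q ∈ Δ(Π) have all coordinates positive, let p ∈ Δ(Π), and let ν̄ maximize ν ↦ AIR_{q,η}(p,ν) over Δ(𝓜×Π). Assume that for every π ∈ Π with p(π) > 0 and every o ∈ O, m_{ν̄}(π,o) > 0 and the posterior ν̄_{π*|π,o} has all coordinates strictly positive. Then sup_{M ∈ 𝓜, π̄ ∈ Π} Σ_{π,o} p(π)·[M(π)](o)·( f_M(π̄) − f_M(π) − (1/η)·log( ν̄_{π*|π,o}(π̄) / q(π̄) ) ) = AIR_{q,η}(p, ν̄). -/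
open Finset

/-- The coefficient of `ν (M, π̄)` in the algorithmic information ratio when the posterior is
replaced by a fixed reference family `r`. -/
noncomputable def linAIR {M P O : Type*} [Fintype P] [Fintype O]
    (Mo : M → P → O → ℝ) (f : M → P → ℝ) (q p : P → ℝ) (η : ℝ)
    (r : P → O → P → ℝ) (x : M × P) : ℝ :=
  ∑ π, ∑ o, p π * Mo x.1 π o *
    (f x.1 x.2 - f x.1 π - (1 / η) * Real.log (r π o x.2 / q x.2))

section

variable {M P O : Type*} [Fintype M] [Fintype P] [Fintype O]

lemma sum_mul_obs_eq_mObs_mul_sum_post (Mo : M → P → O → ℝ) (ν : M × P → ℝ) (π : P) (o : O)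
    (hm : mObs Mo ν π o ≠ 0) (g : P → ℝ) :
    ∑ x : M × P, ν x * Mo x.1 π o * g x.2 =
      mObs Mo ν π o * ∑ π', post Mo ν π o π' * g π' := by
  rw [Fintype.sum_prod_type_right, mul_sum]
  refine sum_congr rfl fun π' _ => ?_
  rw [post, ← mul_assoc, mul_div_cancel₀ _ hm, sum_mul]

lemma sum_post (Mo : M → P → O → ℝ) (ν : M × P → ℝ) (π : P) (o : O)
    (hm : mObs Mo ν π o ≠ 0) : ∑ π', post Mo ν π o π' = 1 := by
  have h := sum_mul_obs_eq_mObs_mul_sum_post Mo ν π o hm fun _ => 1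
  simp only [mul_one] at h
  exact mul_left_cancel₀ hm (by rw [← h, mul_one, mObs])

lemma sum_mul_linAIR (Mo : M → P → O → ℝ) (f : M → P → ℝ) (q p : P → ℝ) (η : ℝ)
    (r : P → O → P → ℝ) (ν : M × P → ℝ) :
    ∑ x, ν x * linAIR Mo f q p η r x =
      ∑ x : M × P, ν x * (∑ π, ∑ o, p π * Mo x.1 π o * (f x.1 x.2 - f x.1 π)) -
        (1 / η) * ∑ π, ∑ o, p π *
          ∑ x : M × P, ν x * Mo x.1 π o * Real.log (r π o x.2 / q x.2) := by
  have h : ∑ π, ∑ o, p π * ∑ x : M × P, ν x * Mo x.1 π o * Real.log (r π o x.2 / q x.2) =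
      ∑ x : M × P, ν x * ∑ π, ∑ o, p π * Mo x.1 π o * Real.log (r π o x.2 / q x.2) := by
    simp only [mul_sum]
    symm
    rw [sum_comm]
    refine sum_congr rfl fun π _ => ?_
    rw [sum_comm]
    exact sum_congr rfl fun o _ => sum_congr rfl fun x _ => by ring
  rw [h, mul_sum, ← sum_sub_distrib]
  refine sum_congr rfl fun x _ => ?_
  simp only [linAIR, mul_sum, ← sum_sub_distrib]
  exact sum_congr rfl fun π _ => sum_congr rfl fun o _ => by ring

/-- At its own posterior, the linearization recovers the algorithmic information ratio. -/
lemma AIR_eq_sum_mul_linAIR (Mo : M → P → O → ℝ) (f : M → P → ℝ) (q p : P → ℝ) (η : ℝ)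
    (ν : M × P → ℝ) (hm : ∀ π, p π ≠ 0 → ∀ o, mObs Mo ν π o ≠ 0) :
    AIR Mo f q p η ν = ∑ x, ν x * linAIR Mo f q p η (post Mo ν) x := by
  simp only [AIR, linAIR, mul_sum]
  rw [sum_comm, sum_comm (s := (univ : Finset (M × P)))]
  refine sum_congr rfl fun π _ => ?_
  rw [sum_comm, sum_comm (s := (univ : Finset (M × P)))]
  refine sum_congr rfl fun o _ => ?_
  rcases eq_or_ne (p π) 0 with h0 | h0
  · simp [h0]
  have key : ∑ x : M × P, ν x * Mo x.1 π o * KLr (post Mo ν π o) q =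
      ∑ x : M × P, ν x * Mo x.1 π o * Real.log (post Mo ν π o x.2 / q x.2) := by
    rw [sum_mul_obs_eq_mObs_mul_sum_post Mo ν π o (hm π h0 o)
      (fun π' => Real.log (post Mo ν π o π' / q π')), ← sum_mul]
    rfl
  rw [← sub_eq_zero, ← sum_sub_distrib]
  have : ∑ x : M × P, (ν x * Mo x.1 π o * KLr (post Mo ν π o) q -
      ν x * Mo x.1 π o * Real.log (post Mo ν π o x.2 / q x.2)) = 0 := by
    rw [sum_sub_distrib, key, sub_self]
  calc _ = -(p π / η) * ∑ x : M × P, (ν x * Mo x.1 π o * KLr (post Mo ν π o) q -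
      ν x * Mo x.1 π o * Real.log (post Mo ν π o x.2 / q x.2)) := by
        rw [mul_sum]
        exact sum_congr rfl fun x _ => by ring
    _ = 0 := by rw [this, mul_zero]

/-- Gibbs' inequality, relative to a positive reference vector. -/
lemma sum_mul_log_div_le (a r q : P → ℝ) (ha : ∀ x, 0 < a x) (hr : ∀ x, 0 < r x)
    (hq : ∀ x, 0 < q x) (hs : ∑ x, r x = ∑ x, a x) :
    ∑ x, a x * Real.log (r x / q x) ≤ ∑ x, a x * Real.log (a x / q x) := by
  have h : ∑ x, (a x * Real.log (r x / q x) - a x * Real.log (a x / q x)) ≤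
      ∑ x, (r x - a x) := by
    refine sum_le_sum fun x _ => ?_
    have h1 := Real.log_le_sub_one_of_pos (div_pos (hr x) (ha x))
    have h2 := mul_le_mul_of_nonneg_left h1 (ha x).le
    rw [mul_sub, mul_div_cancel₀ _ (ha x).ne', mul_one,
      Real.log_div (hr x).ne' (ha x).ne'] at h2
    rw [Real.log_div (hr x).ne' (hq x).ne', Real.log_div (ha x).ne' (hq x).ne']
    linarith
  rw [sum_sub_distrib, sum_sub_distrib, hs, sub_self] at h
  linarith

/-- Among positive reference families, the true posterior minimizes the linearization. -/
lemma sum_mul_linAIR_post_le (Mo : M → P → O → ℝ) (f : M → P → ℝ) (q p : P → ℝ) (η : ℝ)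
    (hη : 0 < η) (hq : ∀ π, 0 < q π) (hp : ∀ π, 0 ≤ p π) (ν : M × P → ℝ) (r : P → O → P → ℝ)
    (hν : ∀ π, 0 < p π → ∀ o, 0 < mObs Mo ν π o ∧ ∀ π', 0 < post Mo ν π o π')
    (hr : ∀ π, 0 < p π → ∀ o, ∀ π', 0 < r π o π')
    (hr1 : ∀ π, 0 < p π → ∀ o, ∑ π', r π o π' = 1) :
    ∑ x, ν x * linAIR Mo f q p η (post Mo ν) x ≤ ∑ x, ν x * linAIR Mo f q p η r x := by
  rw [sum_mul_linAIR, sum_mul_linAIR]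
  refine sub_le_sub_left (mul_le_mul_of_nonneg_left ?_ (by positivity)) _
  refine sum_le_sum fun π _ => sum_le_sum fun o _ => ?_
  rcases (hp π).eq_or_lt with h0 | h0
  · simp [← h0]
  refine mul_le_mul_of_nonneg_left ?_ h0.le
  obtain ⟨hm, hpost⟩ := hν π h0 o
  rw [sum_mul_obs_eq_mObs_mul_sum_post Mo ν π o hm.ne' fun π' => Real.log (r π o π' / q π'),
    sum_mul_obs_eq_mObs_mul_sum_post Mo ν π o hm.ne'
      fun π' => Real.log (post Mo ν π o π' / q π')]
  refine mul_le_mul_of_nonneg_left ?_ hm.le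
  exact sum_mul_log_div_le _ _ _ hpost (hr π h0 o) hq
    ((hr1 π h0 o).trans (sum_post Mo ν π o hm.ne').symm)

/-- First-order optimality: at a maximizer with positive posteriors, the linearization is bounded
by the maximal value at every vertex of the simplex. -/
lemma linAIR_post_le_AIR_of_isMax (Mo : M → P → O → ℝ) (hMo : ∀ m π o, 0 ≤ Mo m π o)
    (f : M → P → ℝ) (q p : P → ℝ) (η : ℝ)
    (hη : 0 < η) (hq : ∀ π, 0 < q π) (hp : ∀ π, 0 ≤ p π) (ν : M × P → ℝ) (hνp : IsProb ν)
    (hmax : ∀ ν' : M × P → ℝ, IsProb ν' → AIR Mo f q p η ν' ≤ AIR Mo f q p η ν)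
    (hν : ∀ π, 0 < p π → ∀ o, 0 < mObs Mo ν π o ∧ ∀ π', 0 < post Mo ν π o π')
    (y : M × P) :
    linAIR Mo f q p η (post Mo ν) y ≤ AIR Mo f q p η ν := by
  classical
  let mix : ℝ → M × P → ℝ := fun t x => (1 - t) * ν x + t * if x = y then 1 else 0
  have hδ : ∀ x, (0 : ℝ) ≤ if x = y then 1 else 0 := fun x => by
    split_ifs <;> norm_num
  have hmix : ∀ t ∈ Set.Ioo (0 : ℝ) 1, IsProb (mix t) := by
    rintro t ⟨h0, h1⟩
    refine ⟨fun x => add_nonneg (mul_nonneg (by linarith) (hνp.1 x))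
      (mul_nonneg h0.le (hδ x)), ?_⟩
    simp [mix, sum_add_distrib, ← mul_sum, hνp.2]
  have hge : ∀ t ∈ Set.Ioo (0 : ℝ) 1, ∀ x, (1 - t) * ν x ≤ mix t x := fun t ht x =>
    le_add_of_nonneg_right (mul_nonneg ht.1.le (hδ x))
  have hmobs : ∀ t ∈ Set.Ioo (0 : ℝ) 1, ∀ π, 0 < p π → ∀ o, 0 < mObs Mo (mix t) π o := by
    intro t ht π hπ o
    have h : (1 - t) * mObs Mo ν π o ≤ mObs Mo (mix t) π o := by
      rw [mObs, mObs, mul_sum]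
      refine sum_le_sum fun x _ => ?_
      rw [← mul_assoc]
      exact mul_le_mul_of_nonneg_right (hge t ht x) (hMo _ _ _)
    exact (mul_pos (by linarith [ht.2]) (hν π hπ o).1).trans_le h
  have hpost : ∀ t ∈ Set.Ioo (0 : ℝ) 1, ∀ π, 0 < p π → ∀ o, ∀ π', 0 < post Mo (mix t) π o π' := by
    intro t ht π hπ o π'
    refine div_pos ?_ (hmobs t ht π hπ o)
    have hnum : 0 < ∑ m, ν (m, π') * Mo m π o := by
      have h := mul_pos ((hν π hπ o).2 π') (hν π hπ o).1
      rwa [post, div_mul_cancel₀ _ (hν π hπ o).1.ne'] at h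
    refine (mul_pos (sub_pos.2 ht.2) hnum).trans_le ?_
    rw [mul_sum]
    refine sum_le_sum fun m _ => ?_
    rw [← mul_assoc]
    exact mul_le_mul_of_nonneg_right (hge t ht _) (hMo _ _ _)
  have hne : ∀ π, p π ≠ 0 → 0 < p π := fun π h => (hp π).lt_of_ne' h
  have hle : ∀ t ∈ Set.Ioo (0 : ℝ) 1,
      linAIR Mo f q p η (post Mo (mix t)) y ≤ AIR Mo f q p η ν := by
    intro t ht
    have h1 := hmax _ (hmix t ht)
    rw [AIR_eq_sum_mul_linAIR Mo f q p η (mix t)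
      fun π h o => (hmobs t ht π (hne π h) o).ne'] at h1
    have h2 : AIR Mo f q p η ν ≤ ∑ x, ν x * linAIR Mo f q p η (post Mo (mix t)) x := by
      rw [AIR_eq_sum_mul_linAIR Mo f q p η ν fun π h o => (hν π (hne π h) o).1.ne']
      exact sum_mul_linAIR_post_le Mo f q p η hη hq hp ν _ hν (hpost t ht)
        fun π hπ o => sum_post Mo _ π o (hmobs t ht π hπ o).ne'
    have h3 : ∑ x, mix t x * linAIR Mo f q p η (post Mo (mix t)) x =
        (1 - t) * ∑ x, ν x * linAIR Mo f q p η (post Mo (mix t)) x +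
          t * linAIR Mo f q p η (post Mo (mix t)) y := by
      generalize linAIR Mo f q p η (post Mo (mix t)) = g
      simp [mix, add_mul, sum_add_distrib, mul_sum, mul_assoc]
    have h4 := mul_le_mul_of_nonneg_left h2 (sub_pos.2 ht.2).le
    exact le_of_mul_le_mul_left (by linarith) ht.1
  have hmix0 : mix 0 = ν := by ext x; simp [mix]
  have hcont : ContinuousAt (fun t => linAIR Mo f q p η (post Mo (mix t)) y) 0 := by
    unfold linAIR
    refine tendsto_finsetSum _ fun π _ => tendsto_finsetSum _ fun o _ => ?_
    rcases (hp π).eq_or_lt with h0 | h0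
    · simp [← h0]
    have hpc : ContinuousAt (fun t => post Mo (mix t) π o y.2) 0 := by
      refine ContinuousAt.div ?_ ?_ (by rw [hmix0]; exact (hν π h0 o).1.ne')
      · simp only [mix]; fun_prop
      · simp only [mObs, mix]; fun_prop
    have hlog : ContinuousAt (fun t => Real.log (post Mo (mix t) π o y.2 / q y.2)) 0 :=
      (hpc.div_const _).log (by
        rw [hmix0]; exact (div_pos ((hν π h0 o).2 _) (hq _)).ne')
    exact (continuousAt_const.sub (hlog.const_mul _)).const_mul _
  have hlim := hcont.tendsto.mono_left (nhdsWithin_le_nhds (s := Set.Ioi 0))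
  rw [hmix0] at hlim
  exact le_of_tendsto hlim
    (Filter.eventually_of_mem (Ioo_mem_nhdsGT one_pos) hle)

end

/-- Identity at the AIR-maximizing belief (Nash equilibrium): if `ν̄` maximizes
`ν ↦ AIR_{q,η}(p,ν)` over the simplex `Δ(𝓜×Π)`, and its posteriors are everywhere
well-defined and strictly positive, then
`sup_{M,π̄} Σ_{π,o} p(π)·[M(π)](o)·( f_M(π̄) − f_M(π) − (1/η)·log(ν̄_{π*|π,o}(π̄)/q(π̄)) )
  = AIR_{q,η}(p,ν̄)`. -/
theorem identity_by_nash_equilibrium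
    {M P O : Type*} [Fintype M] [Nonempty M] [Fintype P] [Nonempty P]
    [Fintype O] [Nonempty O]
    (Mo : M → P → O → ℝ) (hMo : ∀ m π, IsProb (Mo m π))
    (f : M → P → ℝ) (η : ℝ) (hη : 0 < η)
    (q : P → ℝ) (hq : IsProb q) (hqpos : ∀ π, 0 < q π)
    (p : P → ℝ) (hp : IsProb p)
    (νb : M × P → ℝ) (hνb : IsProb νb)
    (hmax : ∀ ν' : M × P → ℝ, IsProb ν' →
      AIR Mo f q p η ν' ≤ AIR Mo f q p η νb)
    (hpos : ∀ π, 0 < p π → ∀ o : O,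
      0 < mObs Mo νb π o ∧ ∀ π', 0 < post Mo νb π o π') :
    (⨆ mp : M × P, ∑ π, ∑ o, p π * Mo mp.1 π o *
        (f mp.1 mp.2 - f mp.1 π - (1 / η) * Real.log (post Mo νb π o mp.2 / q mp.2)))
      = AIR Mo f q p η νb := by
  have hne : ∀ π, p π ≠ 0 → 0 < p π := fun π h => (hp.1 π).lt_of_ne' h
  change (⨆ x, linAIR Mo f q p η (post Mo νb) x) = _
  refine le_antisymm (ciSup_le fun y => linAIR_post_le_AIR_of_isMax Mo (fun m π => (hMo m π).1)
    f q p η hη hqpos hp.1 νb hνb hmax hpos y) ?_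
  rw [AIR_eq_sum_mul_linAIR Mo f q p η νb fun π h o => (hpos π (hne π h) o).1.ne']
  calc ∑ x, νb x * linAIR Mo f q p η (post Mo νb) x
      ≤ ∑ x, νb x * ⨆ y, linAIR Mo f q p η (post Mo νb) y :=
        sum_le_sum fun x _ => mul_le_mul_of_nonneg_left
          (le_ciSup (Set.finite_range _).bddAbove x) (hνb.1 x)
    _ = ⨆ y, linAIR Mo f q p η (post Mo νb) y := by rw [← sum_mul, hνb.2, one_mul]
end

section
/- Concavity of AIR in the belief: for every η > 0, every p ∈ Δ(Π), and every q ∈ Δ(Π) with all coordinates positive, the function ν ↦ AIR_{q,η}(p,ν) is concave on the convex set Δ(𝓜×Π). -/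
open Finset

/-- Tangent-plane lower bound for the perspective function `(a, m) ↦ a * log (a / m / c)`. -/
lemma le_mul_log_div_div {a m x c : ℝ} (ha : 0 ≤ a) (hm : 0 ≤ m) (h : m = 0 → a = 0)
    (hx : 0 < x) (hc : 0 < c) :
    a * Real.log (x / c) + a - m * x ≤ a * Real.log (a / m / c) := by
  rcases ha.eq_or_lt with rfl | ha
  · simpa using mul_nonneg hm hx.le
  have hm' : 0 < m := hm.lt_of_ne fun h0 => ha.ne' (h h0.symm)
  have hlog : Real.log (x / c) - Real.log (a / m / c) = Real.log (m * x / a) := by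
    rw [← Real.log_div (by positivity) (by positivity)]
    congr 1
    field_simp
  have hle := Real.log_le_sub_one_of_pos (show 0 < m * x / a by positivity)
  have hmul := mul_le_mul_of_nonneg_left hle ha.le
  have hcancel : a * (m * x / a - 1) = m * x - a := by field_simp
  rw [← hlog, hcancel] at hmul
  linarith

/-- Joint convexity of `(a, m) ↦ a * log (a / m / c)`. -/
lemma mul_log_div_div_convex {a m b n c s t : ℝ} (ha : 0 ≤ a) (ham : a ≤ m) (hb : 0 ≤ b)
    (hbn : b ≤ n) (hs : 0 ≤ s) (ht : 0 ≤ t) (hc : 0 < c) :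
    (s * a + t * b) * Real.log ((s * a + t * b) / (s * m + t * n) / c) ≤
      s * (a * Real.log (a / m / c)) + t * (b * Real.log (b / n / c)) := by
  have hA : 0 ≤ s * a + t * b := by positivity
  have hAM : s * a + t * b ≤ s * m + t * n := by gcongr
  rcases hA.eq_or_lt with h0 | hA
  · have hsa : s * a = 0 := by nlinarith [mul_nonneg hs ha, mul_nonneg ht hb]
    have htb : t * b = 0 := by nlinarith [mul_nonneg hs ha, mul_nonneg ht hb]
    simp [← mul_assoc, hsa, htb]
  have hM : 0 < s * m + t * n := hA.trans_le hAM
  have hx : 0 < (s * a + t * b) / (s * m + t * n) := by positivity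
  have h₁ := mul_le_mul_of_nonneg_left
    (le_mul_log_div_div ha (ha.trans ham) (fun h => by linarith) hx hc) hs
  have h₂ := mul_le_mul_of_nonneg_left
    (le_mul_log_div_div hb (hb.trans hbn) (fun h => by linarith) hx hc) ht
  have hcancel : (s * m + t * n) * ((s * a + t * b) / (s * m + t * n)) = s * a + t * b := by
    field_simp
  linarith

section JointMass

variable {M P O : Type*} [Fintype M]

/-- The joint mass of `π* = π'` and the observation `o` after playing `π`. -/
noncomputable def jointMass (Mo : M → P → O → ℝ) (ν : M × P → ℝ) (π : P) (o : O) (π' : P) : ℝ :=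
  ∑ m, ν (m, π') * Mo m π o

lemma jointMass_add_smul (Mo : M → P → O → ℝ) (ν μ : M × P → ℝ) (s t : ℝ) (π : P) (o : O)
    (π' : P) : jointMass Mo (s • ν + t • μ) π o π' =
      s * jointMass Mo ν π o π' + t * jointMass Mo μ π o π' := by
  simp [jointMass, mul_sum, ← sum_add_distrib, add_mul, mul_assoc]

lemma jointMass_nonneg {Mo : M → P → O → ℝ} (hMo : ∀ m π o, 0 ≤ Mo m π o) {ν : M × P → ℝ}
    (hν : ∀ x, 0 ≤ ν x) (π : P) (o : O) (π' : P) : 0 ≤ jointMass Mo ν π o π' :=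
  sum_nonneg fun _ _ => mul_nonneg (hν _) (hMo _ _ _)

variable [Fintype P] [Fintype O]

lemma mObs_eq_sum_jointMass (Mo : M → P → O → ℝ) (ν : M × P → ℝ) (π : P) (o : O) :
    mObs Mo ν π o = ∑ π', jointMass Mo ν π o π' := by
  simp only [mObs, jointMass, Fintype.sum_prod_type]
  exact sum_comm

lemma mObs_add_smul (Mo : M → P → O → ℝ) (ν μ : M × P → ℝ) (s t : ℝ) (π : P) (o : O) :
    mObs Mo (s • ν + t • μ) π o = s * mObs Mo ν π o + t * mObs Mo μ π o := by
  simp [mObs, mul_sum, ← sum_add_distrib, add_mul, mul_assoc]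

lemma jointMass_le_mObs {Mo : M → P → O → ℝ} (hMo : ∀ m π o, 0 ≤ Mo m π o) {ν : M × P → ℝ}
    (hν : ∀ x, 0 ≤ ν x) (π : P) (o : O) (π' : P) : jointMass Mo ν π o π' ≤ mObs Mo ν π o := by
  rw [mObs_eq_sum_jointMass]
  exact single_le_sum (f := jointMass Mo ν π o) (fun i _ => jointMass_nonneg hMo hν π o i)
    (mem_univ π')

lemma mObs_mul_KLr_post {Mo : M → P → O → ℝ} (hMo : ∀ m π o, 0 ≤ Mo m π o) {ν : M × P → ℝ}
    (hν : ∀ x, 0 ≤ ν x) (q : P → ℝ) (π : P) (o : O) :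
    mObs Mo ν π o * KLr (post Mo ν π o) q = ∑ π', jointMass Mo ν π o π' *
      Real.log (jointMass Mo ν π o π' / mObs Mo ν π o / q π') := by
  rw [KLr, mul_sum]
  refine sum_congr rfl fun π' _ => ?_
  change _ * (jointMass Mo ν π o π' / mObs Mo ν π o *
    Real.log (jointMass Mo ν π o π' / mObs Mo ν π o / q π')) = _
  rw [← mul_assoc, mul_div_cancel_of_imp']
  intro h
  exact le_antisymm (h ▸ jointMass_le_mObs hMo hν π o π') (jointMass_nonneg hMo hν π o π')

/-- `AIR` is an affine reward gap minus the information cost. -/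
lemma AIR_eq_sub (Mo : M → P → O → ℝ) (f : M → P → ℝ) (q p : P → ℝ) (η : ℝ) (ν : M × P → ℝ) :
    AIR Mo f q p η ν =
      (∑ x : M × P, ν x * ∑ π, ∑ o, p π * Mo x.1 π o * (f x.1 x.2 - f x.1 π)) -
      (1 / η) * ∑ π, p π * ∑ o, mObs Mo ν π o * KLr (post Mo ν π o) q := by
  have hcost : (1 / η) * ∑ π, p π * ∑ o, mObs Mo ν π o * KLr (post Mo ν π o) q =
      ∑ x : M × P, ∑ π, ∑ o, ν x * p π * Mo x.1 π o * ((1 / η) * KLr (post Mo ν π o) q) := by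
    rw [sum_comm, mul_sum]
    refine sum_congr rfl fun π _ => ?_
    rw [sum_comm, mul_sum, mul_sum]
    refine sum_congr rfl fun o _ => ?_
    rw [mObs, sum_mul, mul_sum, mul_sum]
    exact sum_congr rfl fun x _ => by ring
  rw [hcost, AIR, ← sum_sub_distrib]
  refine sum_congr rfl fun x _ => ?_
  simp only [mul_sum, ← sum_sub_distrib]
  exact sum_congr rfl fun π _ => sum_congr rfl fun o _ => by ring

lemma mObs_mul_KLr_post_convex {Mo : M → P → O → ℝ} (hMo : ∀ m π o, 0 ≤ Mo m π o)
    {ν μ : M × P → ℝ} (hν : ∀ x, 0 ≤ ν x) (hμ : ∀ x, 0 ≤ μ x) {s t : ℝ} (hs : 0 ≤ s)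
    (ht : 0 ≤ t) {q : P → ℝ} (hq : ∀ π, 0 < q π) (π : P) (o : O) :
    mObs Mo (s • ν + t • μ) π o * KLr (post Mo (s • ν + t • μ) π o) q ≤
      s * (mObs Mo ν π o * KLr (post Mo ν π o) q) +
        t * (mObs Mo μ π o * KLr (post Mo μ π o) q) := by
  have hνμ : ∀ x, 0 ≤ (s • ν + t • μ) x := fun x =>
    add_nonneg (mul_nonneg hs (hν x)) (mul_nonneg ht (hμ x))
  rw [mObs_mul_KLr_post hMo hνμ, mObs_mul_KLr_post hMo hν, mObs_mul_KLr_post hMo hμ, mul_sum,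
    mul_sum, ← sum_add_distrib]
  refine sum_le_sum fun π' _ => ?_
  rw [jointMass_add_smul, mObs_add_smul]
  exact mul_log_div_div_convex (jointMass_nonneg hMo hν π o π') (jointMass_le_mObs hMo hν π o π')
    (jointMass_nonneg hMo hμ π o π') (jointMass_le_mObs hMo hμ π o π') hs ht (hq π')

end JointMass

/-- Concavity of AIR in the belief: for `η > 0`, `p ∈ Δ(Π)`, and `q ∈ Δ(Π)` with all
coordinates positive, `ν ↦ AIR_{q,η}(p,ν)` is concave on the simplex `Δ(𝓜×Π)`. -/
theorem air_concave_in_belief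
    {M P O : Type*} [Fintype M] [Nonempty M] [Fintype P] [Nonempty P]
    [Fintype O] [Nonempty O]
    (Mo : M → P → O → ℝ) (hMo : ∀ m π, IsProb (Mo m π))
    (f : M → P → ℝ) (η : ℝ) (hη : 0 < η)
    (p : P → ℝ) (hp : IsProb p)
    (q : P → ℝ) (hq : IsProb q) (hqpos : ∀ π, 0 < q π) :
    ConcaveOn ℝ {ν : M × P → ℝ | IsProb ν} (AIR Mo f q p η) := by
  have hMo' : ∀ m π o, 0 ≤ Mo m π o := fun m π => (hMo m π).1
  refine ⟨convex_stdSimplex ℝ (M × P), fun ν hν μ hμ s t hs ht _ => ?_⟩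
  have hcost : ∑ π, p π * ∑ o, mObs Mo (s • ν + t • μ) π o * KLr (post Mo (s • ν + t • μ) π o) q ≤
      s * (∑ π, p π * ∑ o, mObs Mo ν π o * KLr (post Mo ν π o) q) +
        t * (∑ π, p π * ∑ o, mObs Mo μ π o * KLr (post Mo μ π o) q) := by
    rw [mul_sum, mul_sum, ← sum_add_distrib]
    refine sum_le_sum fun π _ => ?_
    rw [mul_left_comm s, mul_left_comm t, ← mul_add, mul_sum _ _ s, mul_sum _ _ t,
      ← sum_add_distrib]
    exact mul_le_mul_of_nonneg_left
      (sum_le_sum fun o _ => mObs_mul_KLr_post_convex hMo' hν.1 hμ.1 hs ht hqpos π o) (hp.1 π)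
  have hreward (g : M × P → ℝ) :
      ∑ x, (s • ν + t • μ) x * g x = s * ∑ x, ν x * g x + t * ∑ x, μ x * g x := by
    simp [mul_sum, ← sum_add_distrib, add_mul, mul_assoc]
  have hscaled := mul_le_mul_of_nonneg_left hcost (one_div_pos.2 hη).le
  simp only [AIR_eq_sub, smul_eq_mul, hreward]
  linarith
end

section
/- Optimality of the Bayesian posterior in the estimation game: fix η > 0, p ∈ Δ(Π), q ∈ Δ(Π) with all coordinates positive, and ν ∈ Δ(𝓜×Π). For any map Q assigning to each (π,o) ∈ Π×O a distribution Q[π,o] ∈ Δ(Π) with all coordinates positive, set B(ν,Q) := Σ_{M,π̄,π,o} ν(M,π̄)·p(π)·[M(π)](o)·( f_M(π̄) − f_M(π) − (1/η)·log( Q[π,o](π̄)/q(π̄) ) ). Then the infimum of B(ν,Q) over all such Q equals AIR_{q,η}(p,ν); moreover, if the posterior ν_{π*|π,o} has all coordinates positive whenever p(π)·m_ν(π,o) > 0, the infimum is attained by any Q satisfying Q[π,o] = ν_{π*|π,o} at every (π,o) with p(π)·m_ν(π,o) > 0. -/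
open Finset

/-- The estimation-game objective
`B(ν,Q) = Σ_{M,π̄,π,o} ν(M,π̄)·p(π)·[M(π)](o)·( f_M(π̄) − f_M(π) − (1/η)·log(Q[π,o](π̄)/q(π̄)) )`. -/
noncomputable def Bfun {M P O : Type*} [Fintype M] [Fintype P] [Fintype O]
    (Mo : M → P → O → ℝ) (f : M → P → ℝ)
    (q p : P → ℝ) (η : ℝ) (ν : M × P → ℝ) (Q : P → O → P → ℝ) : ℝ :=
  ∑ x : M × P, ∑ π, ∑ o, ν x * p π * Mo x.1 π o *
    (f x.1 x.2 - f x.1 π - (1 / η) * Real.log (Q π o x.2 / q x.2))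

/-- The joint weight of `(o, π')` given `π` is `m_ν(π,o)` times the posterior of `π'`. -/
theorem mObs_mul_post {M P O : Type*} [Fintype M] [Fintype P] [Fintype O]
    {Mo : M → P → O → ℝ} (hMo : ∀ m π o, 0 ≤ Mo m π o)
    {ν : M × P → ℝ} (hν : ∀ x, 0 ≤ ν x) (π : P) (o : O) (π' : P) :
    mObs Mo ν π o * post Mo ν π o π' = ∑ m, ν (m, π') * Mo m π o := by
  unfold post
  by_cases h : mObs Mo ν π o = 0
  · rw [h, zero_mul, eq_comm]
    have h0 := (sum_eq_zero_iff_of_nonneg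
      (fun (x : M × P) _ => mul_nonneg (hν x) (hMo x.1 π o))).1 h
    exact sum_eq_zero fun m _ => h0 (m, π') (mem_univ _)
  · exact mul_div_cancel₀ _ h

theorem mObs_nonneg {M P O : Type*} [Fintype M] [Fintype P] [Fintype O]
    {Mo : M → P → O → ℝ} (hMo : ∀ m π o, 0 ≤ Mo m π o)
    {ν : M × P → ℝ} (hν : ∀ x, 0 ≤ ν x) (π : P) (o : O) : 0 ≤ mObs Mo ν π o :=
  sum_nonneg fun x _ => mul_nonneg (hν x) (hMo x.1 π o)

theorem isProb_post {M P O : Type*} [Fintype M] [Fintype P] [Fintype O]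
    {Mo : M → P → O → ℝ} (hMo : ∀ m π o, 0 ≤ Mo m π o)
    {ν : M × P → ℝ} (hν : ∀ x, 0 ≤ ν x) {π : P} {o : O} (h : mObs Mo ν π o ≠ 0) :
    IsProb (post Mo ν π o) := by
  refine ⟨fun π' => div_nonneg (sum_nonneg fun m _ => mul_nonneg (hν _) (hMo _ _ _))
    (mObs_nonneg hMo hν π o), ?_⟩
  simp only [post]
  rw [← sum_div, div_eq_one_iff_eq h, mObs, Fintype.sum_prod_type_right]

theorem sum_mul_mObs {M P O : Type*} [Fintype M] [Fintype P] [Fintype O]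
    {Mo : M → P → O → ℝ} (hMo : ∀ m π, IsProb (Mo m π))
    {p : P → ℝ} (hp : IsProb p) {ν : M × P → ℝ} (hν : IsProb ν) :
    ∑ π, ∑ o, p π * mObs Mo ν π o = 1 := by
  have h (π : P) : ∑ o, mObs Mo ν π o = 1 := by
    simp only [mObs]
    rw [sum_comm]
    simp only [← mul_sum, (hMo _ _).2, mul_one, hν.2]
  simp only [← mul_sum, h, mul_one, hp.2]

/-- Expectations of functions of `(π, o, π*)` can be computed through the posterior. -/
theorem sum_eq_sum_mObs_mul_post {M P O : Type*} [Fintype M] [Fintype P] [Fintype O]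
    {Mo : M → P → O → ℝ} (hMo : ∀ m π o, 0 ≤ Mo m π o)
    {ν : M × P → ℝ} (hν : ∀ x, 0 ≤ ν x) (p : P → ℝ) (L : P → O → P → ℝ) :
    ∑ x : M × P, ∑ π, ∑ o, ν x * p π * Mo x.1 π o * L π o x.2 =
      ∑ π, ∑ o, p π * mObs Mo ν π o * ∑ π', post Mo ν π o π' * L π o π' := by
  rw [sum_comm]
  refine sum_congr rfl fun π _ => ?_
  rw [sum_comm]
  refine sum_congr rfl fun o _ => ?_
  rw [Fintype.sum_prod_type_right, mul_sum]
  refine sum_congr rfl fun π' _ => ?_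
  rw [show p π * mObs Mo ν π o * (post Mo ν π o π' * L π o π') =
    (mObs Mo ν π o * post Mo ν π o π') * (p π * L π o π') by ring,
    mObs_mul_post hMo hν, sum_mul]
  exact sum_congr rfl fun m _ => by ring

theorem sum_mul_const_eq_sum_mObs {M P O : Type*} [Fintype M] [Fintype P] [Fintype O]
    (Mo : M → P → O → ℝ) (ν : M × P → ℝ) (p : P → ℝ) (L : P → O → ℝ) :
    ∑ x : M × P, ∑ π, ∑ o, ν x * p π * Mo x.1 π o * L π o =
      ∑ π, ∑ o, p π * mObs Mo ν π o * L π o := by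
  rw [sum_comm]
  refine sum_congr rfl fun π _ => ?_
  rw [sum_comm]
  refine sum_congr rfl fun o _ => ?_
  simp only [mObs, mul_sum, sum_mul]
  exact sum_congr rfl fun x _ => by ring

/-- Replacing the reference distribution changes the divergence by an expected log-ratio. -/
theorem KLr_sub_sum_log {S : Type*} [Fintype S] (a : S → ℝ) {b q : S → ℝ}
    (hb : ∀ x, 0 < b x) (hq : ∀ x, 0 < q x) :
    KLr a q - ∑ x, a x * Real.log (b x / q x) = KLr a b := by
  unfold KLr
  rw [← sum_sub_distrib]
  refine sum_congr rfl fun x _ => ?_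
  by_cases h : a x = 0
  · simp [h]
  · rw [Real.log_div h (hq x).ne', Real.log_div (hb x).ne' (hq x).ne',
      Real.log_div h (hb x).ne']
    ring

theorem KLr_self {S : Type*} [Fintype S] (a : S → ℝ) : KLr a a = 0 :=
  sum_eq_zero fun x _ => by
    by_cases h : a x = 0 <;> simp [h]

/-- Gibbs' inequality. -/
theorem KLr_nonneg_s10 {S : Type*} [Fintype S] {a b : S → ℝ} (ha : IsProb a) (hb : IsProb b)
    (hpos : ∀ x, 0 < b x) : 0 ≤ KLr a b := by
  have h : ∑ x, (a x - b x) ≤ KLr a b := by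
    refine sum_le_sum fun x _ => ?_
    rcases (ha.1 x).eq_or_lt with h | h
    · simp [← h, (hpos x).le]
    · have h1 := Real.one_sub_inv_le_log_of_pos (div_pos h (hpos x))
      calc a x - b x = a x * (1 - (a x / b x)⁻¹) := by
            field_simp
        _ ≤ _ := mul_le_mul_of_nonneg_left h1 h.le
  simpa [sum_sub_distrib, ha.2, hb.2] using h

/-- If `b` dominates `exp (-t) • a`, the divergence of `a` from `b` is at most `t`. -/
theorem KLr_le_of_exp_neg_mul_le {S : Type*} [Fintype S] {a b : S → ℝ} (ha : IsProb a)
    (hpos : ∀ x, 0 < b x) {t : ℝ} (hab : ∀ x, Real.exp (-t) * a x ≤ b x) :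
    KLr a b ≤ t := by
  calc KLr a b ≤ ∑ x, a x * t := by
        refine sum_le_sum fun x _ => ?_
        rcases (ha.1 x).eq_or_lt with h | h
        · simp [← h]
        · refine mul_le_mul_of_nonneg_left ?_ h.le
          rw [Real.log_le_iff_le_exp (div_pos h (hpos x)), div_le_iff₀ (hpos x)]
          calc a x = Real.exp t * (Real.exp (-t) * a x) := by
                rw [← mul_assoc, ← Real.exp_add]; simp
            _ ≤ _ := mul_le_mul_of_nonneg_left (hab x) (Real.exp_pos t).le
    _ = t := by rw [← sum_mul, ha.2, one_mul]

/-- Any distribution is approximated from above, up to a factor `exp (-t)`, by a strictly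
positive distribution. -/
theorem exists_pos_isProb_exp_neg_mul_le {S : Type*} [Fintype S] {a u : S → ℝ}
    (ha : IsProb a) (hu : IsProb u) (hupos : ∀ x, 0 < u x) {t : ℝ} (ht : 0 < t) :
    ∃ b : S → ℝ, (IsProb b ∧ ∀ x, 0 < b x) ∧ ∀ x, Real.exp (-t) * a x ≤ b x := by
  have hc : 0 < 1 - Real.exp (-t) := sub_pos.2 (Real.exp_lt_one_iff.2 (neg_neg_of_pos ht))
  have hle (x : S) : 0 < (1 - Real.exp (-t)) * u x := mul_pos hc (hupos x)
  have hnn (x : S) : 0 ≤ Real.exp (-t) * a x := mul_nonneg (Real.exp_pos _).le (ha.1 x)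
  refine ⟨fun x => Real.exp (-t) * a x + (1 - Real.exp (-t)) * u x,
    ⟨⟨fun x => (add_pos_of_nonneg_of_pos (hnn x) (hle x)).le, ?_⟩,
      fun x => add_pos_of_nonneg_of_pos (hnn x) (hle x)⟩,
    fun x => le_add_of_nonneg_right (hle x).le⟩
  rw [sum_add_distrib, ← mul_sum, ← mul_sum, ha.2, hu.2]
  ring

/-- The suboptimality of `Q` is the expected divergence of the posterior from `Q`. -/
theorem Bfun_eq_AIR_add {M P O : Type*} [Fintype M] [Fintype P] [Fintype O]
    {Mo : M → P → O → ℝ} (hMo : ∀ m π o, 0 ≤ Mo m π o) (f : M → P → ℝ) (η : ℝ)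
    {q : P → ℝ} (hq : ∀ π, 0 < q π) (p : P → ℝ) {ν : M × P → ℝ} (hν : ∀ x, 0 ≤ ν x)
    {Q : P → O → P → ℝ} (hQ : ∀ π o π', 0 < Q π o π') :
    Bfun Mo f q p η ν Q = AIR Mo f q p η ν +
      1 / η * ∑ π, ∑ o, p π * mObs Mo ν π o * KLr (post Mo ν π o) (Q π o) := by
  have h1 := sum_eq_sum_mObs_mul_post hMo hν p fun π o π' => Real.log (Q π o π' / q π')
  have h2 := sum_mul_const_eq_sum_mObs Mo ν p fun π o => KLr (post Mo ν π o) q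
  simp only [← KLr_sub_sum_log _ (hQ _ _) hq, mul_sub, sum_sub_distrib]
  rw [← h1, ← h2, ← mul_sub, ← sub_eq_iff_eq_add']
  unfold Bfun AIR
  simp only [← sum_sub_distrib, mul_sum]
  refine sum_congr rfl fun x _ => sum_congr rfl fun π _ => sum_congr rfl fun o _ => ?_
  ring

/-- Optimality of the Bayesian posterior in the estimation game: the infimum of
`B(ν,Q)` over all maps `Q` assigning to each `(π,o)` a strictly positive distribution
equals `AIR_{q,η}(p,ν)`; moreover, if the posteriors are strictly positive wherever
`p(π)·m_ν(π,o) > 0`, the infimum is attained by any such `Q` agreeing with the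
posterior there. -/
theorem bayesian_posterior_optimal
    {M P O : Type*} [Fintype M] [Nonempty M] [Fintype P] [Nonempty P]
    [Fintype O] [Nonempty O]
    (Mo : M → P → O → ℝ) (hMo : ∀ m π, IsProb (Mo m π))
    (f : M → P → ℝ) (η : ℝ) (hη : 0 < η)
    (q : P → ℝ) (hq : IsProb q) (hqpos : ∀ π, 0 < q π)
    (p : P → ℝ) (hp : IsProb p)
    (ν : M × P → ℝ) (hν : IsProb ν) :
    sInf ((fun Q => Bfun Mo f q p η ν Q) ''
        {Q : P → O → P → ℝ | ∀ π o, IsProb (Q π o) ∧ ∀ π', 0 < Q π o π'})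
      = AIR Mo f q p η ν ∧
    ((∀ π o, 0 < p π * mObs Mo ν π o → ∀ π', 0 < post Mo ν π o π') →
      ∀ Q ∈ {Q : P → O → P → ℝ | ∀ π o, IsProb (Q π o) ∧ ∀ π', 0 < Q π o π'},
        (∀ π o, 0 < p π * mObs Mo ν π o → Q π o = post Mo ν π o) →
        Bfun Mo f q p η ν Q = AIR Mo f q p η ν) := by
  have hMo0 (m : M) (π : P) (o : O) : 0 ≤ Mo m π o := (hMo m π).1 o
  have hw (π : P) (o : O) : 0 ≤ p π * mObs Mo ν π o :=
    mul_nonneg (hp.1 π) (mObs_nonneg hMo0 hν.1 π o)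
  refine ⟨?_, fun _ Q hQ hQpost => ?_⟩
  · refine IsGLB.csInf_eq ⟨?_, fun b hb => ?_⟩
      (Set.Nonempty.image _ ⟨fun _ _ => q, fun _ _ => ⟨hq, hqpos⟩⟩)
    · rintro _ ⟨Q, hQ, rfl⟩
      simp only [Bfun_eq_AIR_add hMo0 f η hqpos p hν.1 fun π o => (hQ π o).2]
      refine le_add_of_nonneg_right (mul_nonneg (one_div_pos.2 hη).le
        (sum_nonneg fun π _ => sum_nonneg fun o _ => ?_))
      by_cases h : mObs Mo ν π o = 0
      · simp [h]
      · exact mul_nonneg (hw π o)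
          (KLr_nonneg_s10 (isProb_post hMo0 hν.1 h) (hQ π o).1 (hQ π o).2)
    · refine le_of_forall_pos_le_add fun δ hδ => ?_
      have hQ (π : P) (o : O) : ∃ b : P → ℝ, (IsProb b ∧ ∀ x, 0 < b x) ∧
          (mObs Mo ν π o ≠ 0 → KLr (post Mo ν π o) b ≤ η * δ) := by
        by_cases h : mObs Mo ν π o = 0
        · exact ⟨q, ⟨hq, hqpos⟩, fun h' => (h' h).elim⟩
        · have ha := isProb_post hMo0 hν.1 h
          obtain ⟨b, hb, hab⟩ := exists_pos_isProb_exp_neg_mul_le ha hq hqpos (mul_pos hη hδ)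
          exact ⟨b, hb, fun _ => KLr_le_of_exp_neg_mul_le ha hb.2 hab⟩
      choose Q hQ hKL using hQ
      refine (hb ⟨Q, hQ, rfl⟩).trans ?_
      simp only [Bfun_eq_AIR_add hMo0 f η hqpos p hν.1 fun π o => (hQ π o).2]
      refine add_le_add_right ?_ _
      have hsum : ∑ π, ∑ o, p π * mObs Mo ν π o * KLr (post Mo ν π o) (Q π o) ≤ η * δ := by
        calc _ ≤ ∑ π, ∑ o, p π * mObs Mo ν π o * (η * δ) := by
              refine sum_le_sum fun π _ => sum_le_sum fun o _ => ?_
              by_cases h : mObs Mo ν π o = 0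
              · simp [h]
              · exact mul_le_mul_of_nonneg_left (hKL π o h) (hw π o)
          _ = η * δ := by
              simp only [← sum_mul]
              rw [sum_mul_mObs hMo hp hν, one_mul]
      rw [one_div, inv_mul_le_iff₀ hη]
      exact hsum
  · rw [Bfun_eq_AIR_add hMo0 f η hqpos p hν.1 fun π o => (hQ π o).2, add_eq_left]
    refine mul_eq_zero_of_right _ (sum_eq_zero fun π _ => sum_eq_zero fun o _ => ?_)
    rcases (hw π o).eq_or_lt with h | h
    · rw [← h, zero_mul]
    · rw [hQpost π o h, KLr_self, mul_zero]
end
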